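/- arXiv:1212.5099 — 3 statements merged into one kernel-verified Lean document; each statement's English description precedes it below -/
import Mathlib

section
/- Let m ≥ 1 and n ≥ 1 be integers and let u_0 : ℝ^n → ℝ be continuous and bounded. Define u(x,t) = α_{m,n} t^{-n/(2m)} ∫_{ℝ^n} u_0(x−y) f_{m,n}(|y|/t^{1/(2m)}) dy for t > 0. Then u is smooth and bounded on ℝ^n × (0,∞), satisfies the polyharmonic heat equation ∂_t u + (−Δ)^m u = 0 on ℝ^n × (0,∞), and u(x,t) → u_0(x) locally uniformly in x as t → 0^+. -/
open MeasureTheory Real Filter Topology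

noncomputable def besselJ (ν y : ℝ) : ℝ :=
  ∑' k : ℕ, (-1 : ℝ) ^ k * (y / 2) ^ ((2 * k : ℝ) + ν) /
    (Nat.factorial k * Real.Gamma ((k : ℝ) + ν + 1))

noncomputable def fmn (m n : ℕ) (η : ℝ) : ℝ :=
  η ^ ((1 : ℝ) - n) *
    ∫ s in Set.Ioi (0 : ℝ),
      Real.exp (-(s ^ (2 * m))) * (η * s) ^ ((n : ℝ) / 2) *
        besselJ (((n : ℝ) - 2) / 2) (η * s)

noncomputable def pd {n : ℕ} (i : Fin n) (f : EuclideanSpace ℝ (Fin n) → ℝ)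
    (x : EuclideanSpace ℝ (Fin n)) : ℝ :=
  fderiv ℝ f x (EuclideanSpace.single i 1)

/-- The Laplacian on `ℝⁿ`, as a sum of second partial derivatives. -/
noncomputable def lap (n : ℕ) (f : EuclideanSpace ℝ (Fin n) → ℝ) :
    EuclideanSpace ℝ (Fin n) → ℝ :=
  fun x => ∑ i : Fin n, pd i (pd i f) x

section Proof
set_option linter.unusedSectionVars false
open scoped SchwartzMap ContDiff FourierTransform LineDeriv


section PartA
variable {V : Type} [NormedAddCommGroup V] [InnerProductSpace ℝ V]

noncomputable def qpoly (m : ℕ) (x : V) : ℝ := ((2 * π) ^ 2 * ‖x‖ ^ 2) ^ m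

lemma qpoly_temperate (m : ℕ) : (fun x : V => - qpoly m x).HasTemperateGrowth := by
  unfold qpoly
  have h : (fun x : V => ‖x‖ ^ 2).HasTemperateGrowth := Function.hasTemperateGrowth_norm_sq V
  have h2 : (fun x : V => (2 * π) ^ 2 * ‖x‖ ^ 2).HasTemperateGrowth :=
    (Function.HasTemperateGrowth.const _).mul h
  exact (h2.pow m).neg

lemma qpoly_ge {m : ℕ} (hm : 1 ≤ m) (x : V) : ‖x‖ - 1 ≤ qpoly m x := by
  unfold qpoly
  have hpi := Real.pi_gt_three
  rcases le_or_gt 1 ‖x‖ with h | h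
  · have h1 : ‖x‖ ≤ (2 * π) ^ 2 * ‖x‖ ^ 2 := by
      have h3 : 1 ≤ (2 * π) ^ 2 := one_le_pow₀ (by linarith)
      nlinarith [sq_nonneg ‖x‖]
    have h2 : (2 * π) ^ 2 * ‖x‖ ^ 2 ≤ ((2 * π) ^ 2 * ‖x‖ ^ 2) ^ m :=
      le_self_pow₀ (h.trans h1) (by omega)
    linarith
  · have : 0 ≤ ((2 * π) ^ 2 * ‖x‖ ^ 2) ^ m := by positivity
    linarith

lemma poly_exp_bound {m : ℕ} (hm : 1 ≤ m) (k : ℕ) (x : V) :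
    (1 + ‖x‖) ^ k * Real.exp (- qpoly m x) ≤ k.factorial * Real.exp 2 := by
  have h1 : Real.exp (- qpoly m x) ≤ Real.exp 2 * Real.exp (-(1 + ‖x‖)) := by
    rw [← Real.exp_add]
    apply Real.exp_le_exp.2
    linarith [qpoly_ge hm x]
  have h2 : (1 + ‖x‖) ^ k ≤ k.factorial * Real.exp (1 + ‖x‖) := by
    have := Real.pow_div_factorial_le_exp (1 + ‖x‖) (by positivity) k
    rw [div_le_iff₀ (by positivity)] at this
    linarith
  calc _ ≤ (k.factorial * Real.exp (1 + ‖x‖)) * (Real.exp 2 * Real.exp (-(1 + ‖x‖))) := by gcongr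
    _ = k.factorial * Real.exp 2 * (Real.exp (1 + ‖x‖) * Real.exp (-(1 + ‖x‖))) := by ring
    _ = _ := by rw [← Real.exp_add]; simp

noncomputable def gS (V : Type) [NormedAddCommGroup V] [InnerProductSpace ℝ V]
    (m : ℕ) (hm : 1 ≤ m) : 𝓢(V, ℝ) where
  toFun x := Real.exp (- qpoly m x)
  smooth' := Real.contDiff_exp.comp (qpoly_temperate m).1
  decay' k n := by
    obtain ⟨l, C, hC, hb⟩ := (qpoly_temperate (V := V) m).norm_iteratedFDeriv_le_uniform n
    refine ⟨n.factorial * (C + 1) ^ n * ((k + l * n).factorial * Real.exp 2), fun x => ?_⟩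
    have h := norm_iteratedFDeriv_comp_le (𝕜 := ℝ) (g := Real.exp) (f := fun x : V => - qpoly m x)
      (n := n) (N := ∞) Real.contDiff_exp (qpoly_temperate m).1 (mod_cast le_top) x
      (C := Real.exp (- qpoly m x)) (D := (C + 1) * (1 + ‖x‖) ^ l) (fun i _ => by
        rw [norm_iteratedFDeriv_eq_norm_iteratedDeriv, iteratedDeriv_eq_iterate,
          Real.iter_deriv_exp]
        simp) (fun i hi hin => by
        refine (hb i hin x).trans ?_
        have h1 : 1 ≤ (C + 1) * (1 + ‖x‖) ^ l := by
          have : (1:ℝ) ≤ (1 + ‖x‖) ^ l := one_le_pow₀ (by linarith [norm_nonneg x])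
          nlinarith
        refine le_trans ?_ (le_self_pow₀ h1 (by omega))
        gcongr
        linarith)
    calc _ ≤ (1 + ‖x‖) ^ k * (n.factorial * Real.exp (- qpoly m x) * ((C + 1) * (1 + ‖x‖) ^ l) ^ n) := by
          gcongr
          · linarith
          · exact h
      _ = n.factorial * (C + 1) ^ n * ((1 + ‖x‖) ^ (k + l * n) * Real.exp (- qpoly m x)) := by
          rw [mul_pow, ← pow_mul, pow_add]; ring
      _ ≤ _ := by
          exact mul_le_mul_of_nonneg_left (poly_exp_bound hm _ x) (by positivity)

lemma gS_apply (m : ℕ) (hm : 1 ≤ m) (x : V) : gS V m hm x = Real.exp (- qpoly m x) := rfl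

noncomputable def gC (V : Type) [NormedAddCommGroup V] [InnerProductSpace ℝ V]
    (m : ℕ) (hm : 1 ≤ m) : 𝓢(V, ℂ) := (gS V m hm).postcompCLM Complex.ofRealCLM

lemma gC_apply (m : ℕ) (hm : 1 ≤ m) (x : V) : gC V m hm x = Complex.exp (- (qpoly m x : ℂ)) := by
  simp [gC, gS_apply]

end PartA

section PartB
variable {E : Type} [NormedAddCommGroup E] [NormedSpace ℝ E] [FiniteDimensional ℝ E]
  [MeasurableSpace E] [BorelSpace E]

lemma schwartz_bound {V : Type} [NormedAddCommGroup V] [NormedSpace ℝ V] (G : 𝓢(E, V)) (N : ℕ) :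
    ∃ C, 0 ≤ C ∧ ∀ w, ‖G w‖ ≤ C * ((1 + ‖w‖) ^ N)⁻¹ := by
  refine ⟨2 ^ (N, 0).1 * (Finset.Iic (N, 0)).sup (fun m => SchwartzMap.seminorm ℝ m.1 m.2) G,
    by positivity, fun w => ?_⟩
  have := SchwartzMap.one_add_le_sup_seminorm_apply (𝕜 := ℝ) (m := (N, 0)) (k := N) (n := 0)
    le_rfl le_rfl G w
  rw [norm_iteratedFDeriv_zero] at this
  rw [← div_eq_mul_inv, le_div_iff₀ (by positivity), mul_comm]
  exact this

variable (μ : Measure E) [μ.IsAddHaarMeasure]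

lemma dom_bound {V : Type} [NormedAddCommGroup V] [NormedSpace ℝ V] (G : 𝓢(E, V)) (p₀ : E × ℝ)
    (hp₀ : 0 < p₀.2) :
    ∃ b : E → ℝ, Integrable b μ ∧ ∀ y, ∀ p : E × ℝ, ‖p.1 - p₀.1‖ ≤ 1 → p₀.2 / 2 ≤ p.2 →
      ‖G (p.2 • (p.1 - y))‖ ≤ b y := by
  set N := Module.finrank ℝ E + 1
  obtain ⟨C, hC, hb⟩ := schwartz_bound G N
  set A := 2 + ‖p₀.1‖ + 2 / p₀.2
  refine ⟨fun y => C * A ^ N * (1 + ‖y‖) ^ (-(N : ℝ)), ?_, fun y p h1 h2 => ?_⟩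
  · apply Integrable.const_mul
    apply integrable_one_add_norm
    simp [N]
  · have hA : 0 < A := by positivity
    refine (hb _).trans ?_
    dsimp only
    rw [mul_assoc]
    gcongr
    rw [Real.rpow_neg (by positivity), Real.rpow_natCast, ← div_eq_mul_inv,
      inv_eq_one_div, div_le_div_iff₀ (by positivity) (by positivity), one_mul, ← mul_pow]
    gcongr
    have h3 : ‖y‖ ≤ ‖p₀.1‖ + 1 + ‖p.1 - y‖ := by
      have : y = p₀.1 + (p.1 - p₀.1) - (p.1 - y) := by abel
      calc ‖y‖ = ‖p₀.1 + (p.1 - p₀.1) - (p.1 - y)‖ := by rw [← this]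
        _ ≤ ‖p₀.1‖ + ‖p.1 - p₀.1‖ + ‖p.1 - y‖ := (norm_sub_le _ _).trans (by gcongr; exact norm_add_le _ _)
        _ ≤ _ := by gcongr
    have h4 : ‖p.1 - y‖ ≤ 2 / p₀.2 * ‖p.2 • (p.1 - y)‖ := by
      rw [norm_smul, Real.norm_of_nonneg (by linarith)]
      calc ‖p.1 - y‖ = 2 / p₀.2 * (p₀.2 / 2 * ‖p.1 - y‖) := by field_simp
        _ ≤ _ := by gcongr
    have h5 : 0 ≤ ‖p.2 • (p.1 - y)‖ := norm_nonneg _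
    have h6 : 0 ≤ 2 / p₀.2 := by positivity
    have h7 := norm_nonneg p₀.1
    simp only [A]
    nlinarith

noncomputable def TT {V : Type} [NormedAddCommGroup V] [NormedSpace ℝ V] (u₀ : E → ℝ) (G : 𝓢(E, V))
    (p : E × ℝ) : V := ∫ y, u₀ y • G (p.2 • (p.1 - y)) ∂μ

noncomputable def D1 {V : Type} [NormedAddCommGroup V] [NormedSpace ℝ V] (G : 𝓢(E, V)) :
    𝓢(E, E →L[ℝ] V) := SchwartzMap.fderivCLM ℝ E V G

noncomputable def D2 {V : Type} [NormedAddCommGroup V] [NormedSpace ℝ V] (G : 𝓢(E, V)) : 𝓢(E, V) :=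
  SchwartzMap.bilinLeftCLM (ContinuousLinearMap.id ℝ (E →L[ℝ] V)) (g := id)
    Function.HasTemperateGrowth.id (D1 G)

lemma D1_apply {V : Type} [NormedAddCommGroup V] [NormedSpace ℝ V] (G : 𝓢(E, V)) (w : E) :
    D1 G w = fderiv ℝ G w := rfl
lemma D2_apply {V : Type} [NormedAddCommGroup V] [NormedSpace ℝ V] (G : 𝓢(E, V)) (w : E) :
    D2 G w = fderiv ℝ G w w := rfl

variable {V : Type} [NormedAddCommGroup V] [NormedSpace ℝ V] 

noncomputable def LL1 (E V : Type) [NormedAddCommGroup E] [NormedSpace ℝ E] [NormedAddCommGroup V]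
    [NormedSpace ℝ V] : (E →L[ℝ] V) →L[ℝ] (E × ℝ →L[ℝ] V) :=
  (ContinuousLinearMap.compL ℝ (E × ℝ) E V).flip (ContinuousLinearMap.fst ℝ E ℝ)
noncomputable def LL2 (E V : Type) [NormedAddCommGroup E] [NormedSpace ℝ E] [NormedAddCommGroup V]
    [NormedSpace ℝ V] : V →L[ℝ] (E × ℝ →L[ℝ] V) :=
  ContinuousLinearMap.smulRightL ℝ (E × ℝ) V (ContinuousLinearMap.snd ℝ E ℝ)

lemma LL1_apply (A : E →L[ℝ] V) (p : E × ℝ) : LL1 E V A p = A p.1 := rfl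
lemma LL2_apply (v : V) (p : E × ℝ) : LL2 E V v p = p.2 • v := rfl

lemma TT_integrable {u₀ : E → ℝ} (hc : Continuous u₀) {M : ℝ} (hM : ∀ x, |u₀ x| ≤ M)
    (G : 𝓢(E, V)) (p : E × ℝ) (hp : 0 < p.2) :
    Integrable (fun y => u₀ y • G (p.2 • (p.1 - y))) μ := by
  obtain ⟨b, hb, h⟩ := dom_bound μ G p hp
  refine Integrable.mono' (hb.const_mul M) ?_ (Eventually.of_forall fun y => ?_)
  · exact Continuous.aestronglyMeasurable (by fun_prop)
  · rw [norm_smul]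
    have hM0 : 0 ≤ M := (abs_nonneg _).trans (hM 0)
    gcongr
    · exact hM y
    · exact h y p (by simp) (by linarith)

lemma TT_hasFDerivAt [CompleteSpace V] {u₀ : E → ℝ} (hc : Continuous u₀) {M : ℝ} (hM : ∀ x, |u₀ x| ≤ M)
    (G : 𝓢(E, V)) (p₀ : E × ℝ) (hp : 0 < p₀.2) :
    HasFDerivAt (TT μ u₀ G)
      (p₀.2 • LL1 E V (TT μ u₀ (D1 G) p₀) + p₀.2⁻¹ • LL2 E V (TT μ u₀ (D2 G) p₀)) p₀ := by
  have hM0 : 0 ≤ M := (abs_nonneg _).trans (hM 0)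
  obtain ⟨b1, hb1, h1⟩ := dom_bound μ (D1 G) p₀ hp
  obtain ⟨b2, hb2, h2⟩ := dom_bound μ (D2 G) p₀ hp
  set F' : E × ℝ → E → (E × ℝ →L[ℝ] V) := fun p y =>
    p.2 • LL1 E V (u₀ y • D1 G (p.2 • (p.1 - y))) + p.2⁻¹ • LL2 E V (u₀ y • D2 G (p.2 • (p.1 - y)))
    with hF'
  have i1 := TT_integrable μ hc hM (D1 G) p₀ hp
  have i2 := TT_integrable μ hc hM (D2 G) p₀ hp
  have j1 : Integrable (fun y => p₀.2 • LL1 E V (u₀ y • D1 G (p₀.2 • (p₀.1 - y)))) μ :=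
    Integrable.smul (𝕜 := ℝ) p₀.2 ((LL1 E V).integrable_comp i1)
  have j2 : Integrable (fun y => p₀.2⁻¹ • LL2 E V (u₀ y • D2 G (p₀.2 • (p₀.1 - y)))) μ :=
    Integrable.smul (𝕜 := ℝ) p₀.2⁻¹ ((LL2 E V).integrable_comp i2)
  have hintg : ∫ y, F' p₀ y ∂μ = p₀.2 • LL1 E V (TT μ u₀ (D1 G) p₀) + p₀.2⁻¹ • LL2 E V (TT μ u₀ (D2 G) p₀) := by
    simp only [hF']
    rw [integral_add j1 j2, integral_smul, integral_smul, ContinuousLinearMap.integral_comp_comm _ i1,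
      ContinuousLinearMap.integral_comp_comm _ i2]
    rfl
  rw [← hintg]
  have hs : Metric.ball p₀ (min 1 (p₀.2 / 2)) ∈ 𝓝 p₀ := Metric.ball_mem_nhds _ (by positivity)
  have hball : ∀ p ∈ Metric.ball p₀ (min 1 (p₀.2 / 2)),
      ‖p.1 - p₀.1‖ ≤ 1 ∧ p₀.2 / 2 ≤ p.2 ∧ p.2 ≤ 2 * p₀.2 := by
    intro p hp'
    rw [Metric.mem_ball, lt_min_iff, dist_eq_norm, Prod.norm_def] at hp'
    have a1 : ‖p.1 - p₀.1‖ < 1 := (le_max_left _ _).trans_lt hp'.1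
    have a2 : |p.2 - p₀.2| < p₀.2 / 2 := (le_max_right _ _).trans_lt hp'.2
    rw [abs_lt] at a2
    exact ⟨a1.le, by linarith, by linarith⟩
  refine hasFDerivAt_integral_of_dominated_of_fderiv_le (F' := F')
    (bound := fun y => (2 * p₀.2) * (‖LL1 E V‖ * (M * b1 y)) + (p₀.2 / 2)⁻¹ * (‖LL2 E V‖ * (M * b2 y)))
    hs ?_ (TT_integrable μ hc hM G p₀ hp) ?_ ?_ ?_ ?_
  · exact Eventually.of_forall fun p => Continuous.aestronglyMeasurable (by fun_prop)
  · exact j1.aestronglyMeasurable.add j2.aestronglyMeasurable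
  · refine Eventually.of_forall fun y p hp' => ?_
    obtain ⟨a, b, c⟩ := hball p hp'
    simp only [hF']
    refine (norm_add_le _ _).trans ?_
    have e1 : ‖LL1 E V (u₀ y • D1 G (p.2 • (p.1 - y)))‖ ≤ ‖LL1 E V‖ * (M * b1 y) := by
      refine ((LL1 E V).le_opNorm _).trans ?_
      rw [norm_smul]
      gcongr
      · exact hM y
      · exact h1 y p a b
    have e2 : ‖LL2 E V (u₀ y • D2 G (p.2 • (p.1 - y)))‖ ≤ ‖LL2 E V‖ * (M * b2 y) := by
      refine ((LL2 E V).le_opNorm _).trans ?_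
      rw [norm_smul]
      gcongr
      · exact hM y
      · exact h2 y p a b
    rw [norm_smul, norm_smul, norm_inv, Real.norm_of_nonneg (by linarith : 0 ≤ p.2)]
    gcongr
  · exact (((hb1.const_mul _).const_mul _).const_mul _).add (((hb2.const_mul _).const_mul _).const_mul _)
  · refine Eventually.of_forall fun y p hp' => ?_
    obtain ⟨a, b, c⟩ := hball p hp'
    have hp2 : p.2 ≠ 0 := by linarith
    have hw : HasFDerivAt (fun p : E × ℝ => p.2 • (p.1 - y))
        (p.2 • ContinuousLinearMap.fst ℝ E ℝ + (ContinuousLinearMap.snd ℝ E ℝ).smulRight (p.1 - y)) p := by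
      exact (hasFDerivAt_snd (𝕜 := ℝ) (p := p)).smul ((hasFDerivAt_fst (𝕜 := ℝ) (p := p)).sub_const y)
    have := ((G.hasFDerivAt (p.2 • (p.1 - y))).comp p hw).const_smul (u₀ y)
    refine this.congr_fderiv ?_
    refine ContinuousLinearMap.ext fun v => ?_
    simp [hF', LL1_apply, LL2_apply, D1_apply, D2_apply, smul_smul]
    rw [show p.2⁻¹ * (u₀ y * p.2) = u₀ y by field_simp, mul_comm p.2, ← smul_sub v.2, smul_smul]

lemma TT_contDiffOn_nat {u₀ : E → ℝ} (hc : Continuous u₀) {M : ℝ} (hM : ∀ x, |u₀ x| ≤ M) (k : ℕ) :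
    ∀ (V : Type) [NormedAddCommGroup V] [NormedSpace ℝ V] [CompleteSpace V] (G : 𝓢(E, V)),
    ContDiffOn ℝ k (TT μ u₀ G) (Set.univ ×ˢ Set.Ioi (0 : ℝ)) := by
  have hopen : IsOpen ((Set.univ : Set E) ×ˢ Set.Ioi (0 : ℝ)) := isOpen_univ.prod isOpen_Ioi
  induction k with
  | zero =>
    intro V _ _ _ G
    apply contDiffOn_zero.2
    intro p hp
    exact (TT_hasFDerivAt μ hc hM G p hp.2).continuousAt.continuousWithinAt
  | succ k ih =>
    intro V _ _ _ G
    have : ((k + 1 : ℕ) : ℕ∞ω) = (k : ℕ∞ω) + 1 := by norm_cast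
    rw [this, contDiffOn_succ_iff_fderiv_of_isOpen hopen]
    refine ⟨fun p hp => (TT_hasFDerivAt μ hc hM G p hp.2).differentiableAt.differentiableWithinAt,
      by simp, ?_⟩
    refine ContDiffOn.congr (f := fun p =>
      p.2 • LL1 E V (TT μ u₀ (D1 G) p) + p.2⁻¹ • LL2 E V (TT μ u₀ (D2 G) p)) ?_
      (fun p hp => (TT_hasFDerivAt μ hc hM G p hp.2).fderiv)
    have h1 := ih _ (D1 G)
    have h2 := ih _ (D2 G)
    refine ContDiffOn.add (ContDiffOn.smul contDiffOn_snd ((LL1 E V).contDiff.comp_contDiffOn h1))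
      (ContDiffOn.smul (ContDiffOn.inv contDiffOn_snd ?_) ((LL2 E V).contDiff.comp_contDiffOn h2))
    intro p hp
    exact ne_of_gt hp.2

lemma TT_contDiffOn [CompleteSpace V] {u₀ : E → ℝ} (hc : Continuous u₀) {M : ℝ} (hM : ∀ x, |u₀ x| ≤ M)
    (G : 𝓢(E, V)) :
    ContDiffOn ℝ (⊤ : ℕ∞) (TT μ u₀ G) (Set.univ ×ˢ Set.Ioi (0 : ℝ)) := by
  rw [contDiffOn_infty]
  exact fun k => TT_contDiffOn_nat μ hc hM k V G

end PartB


section PartC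
variable {n : ℕ}

local notation "EE" => EuclideanSpace ℝ (Fin n)

noncomputable def lapS {F : Type} [NormedAddCommGroup F] [NormedSpace ℝ F] (G : 𝓢(EE, F)) : 𝓢(EE, F) :=
  ∑ i : Fin n, ∂_{(EuclideanSpace.single i (1 : ℝ) : EE)} (∂_{(EuclideanSpace.single i (1 : ℝ) : EE)} G)

lemma TT_hasFDerivAt_x {u₀ : EE → ℝ} (hc : Continuous u₀) {M : ℝ} (hM : ∀ x, |u₀ x| ≤ M)
    (G : 𝓢(EE, ℝ)) (x : EE) {l : ℝ} (hl : 0 < l) :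
    HasFDerivAt (fun x => TT volume u₀ G (x, l)) (l • TT volume u₀ (D1 G) (x, l)) x := by
  have h0 := TT_hasFDerivAt volume hc hM G (x, l) hl
  have h := HasFDerivAt.comp (g := TT volume u₀ G) (f := fun e : EE => (e, l)) x h0
    (hasFDerivAt_prodMk_left (𝕜 := ℝ) x l)
  refine h.congr_fderiv ?_
  ext v
  simp only [ContinuousLinearMap.comp_apply, ContinuousLinearMap.inl_apply,
    add_apply, smul_apply, LL1_apply, LL2_apply, zero_smul,
    smul_zero, add_zero]

lemma TT_hasDerivAt {u₀ : EE → ℝ} (hc : Continuous u₀) {M : ℝ} (hM : ∀ x, |u₀ x| ≤ M)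
    (G : 𝓢(EE, ℝ)) (x : EE) {l : ℝ} (hl : 0 < l) :
    HasDerivAt (fun s => TT volume u₀ G (x, s)) (l⁻¹ * TT volume u₀ (D2 G) (x, l)) l := by
  have h0 := TT_hasFDerivAt volume hc hM G (x, l) hl
  have h := HasFDerivAt.comp (g := TT volume u₀ G) (f := fun s : ℝ => (x, s)) l h0
    (hasFDerivAt_prodMk_right (𝕜 := ℝ) x l)
  have := h.hasDerivAt
  refine HasDerivAt.congr_deriv this ?_
  simp only [ContinuousLinearMap.comp_apply, ContinuousLinearMap.inr_apply,
    add_apply, smul_apply, LL1_apply, LL2_apply, one_mul,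
    smul_eq_mul, map_zero, mul_zero, zero_add]

lemma TT_eval {u₀ : EE → ℝ} (hc : Continuous u₀) {M : ℝ} (hM : ∀ x, |u₀ x| ≤ M)
    (G : 𝓢(EE, ℝ)) (x : EE) {l : ℝ} (hl : 0 < l) (v : EE) :
    TT volume u₀ (D1 G) (x, l) v = TT volume u₀ (∂_{v} G) (x, l) := by
  unfold TT
  rw [ContinuousLinearMap.integral_apply (TT_integrable volume hc hM (D1 G) (x, l) hl)]
  rfl

lemma pd_TT {u₀ : EE → ℝ} (hc : Continuous u₀) {M : ℝ} (hM : ∀ x, |u₀ x| ≤ M)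
    (G : 𝓢(EE, ℝ)) {l : ℝ} (hl : 0 < l) (c : ℝ) (i : Fin n) :
    pd i (fun x => c * TT volume u₀ G (x, l)) =
      fun x => (c * l) * TT volume u₀ (∂_{(EuclideanSpace.single i (1 : ℝ) : EE)} G) (x, l) := by
  ext x
  unfold pd
  rw [((TT_hasFDerivAt_x hc hM G x hl).const_mul c).fderiv]
  simp only [smul_apply, smul_eq_mul, TT_eval hc hM G x hl]
  ring

lemma TT_sum {u₀ : EE → ℝ} (hc : Continuous u₀) {M : ℝ} (hM : ∀ x, |u₀ x| ≤ M)
    (G : Fin n → 𝓢(EE, ℝ)) (x : EE) {l : ℝ} (hl : 0 < l) :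
    TT volume u₀ (∑ i, G i) (x, l) = ∑ i, TT volume u₀ (G i) (x, l) := by
  unfold TT
  rw [← integral_finsetSum _ (fun i _ => TT_integrable volume hc hM (G i) (x, l) hl)]
  congr 1
  ext y
  simp [Finset.mul_sum]

lemma TT_add {u₀ : EE → ℝ} (hc : Continuous u₀) {M : ℝ} (hM : ∀ x, |u₀ x| ≤ M)
    (G G' : 𝓢(EE, ℝ)) (x : EE) {l : ℝ} (hl : 0 < l) :
    TT volume u₀ (G + G') (x, l) = TT volume u₀ G (x, l) + TT volume u₀ G' (x, l) := by
  unfold TT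
  rw [← integral_add (TT_integrable volume hc hM G (x, l) hl) (TT_integrable volume hc hM G' (x, l) hl)]
  congr 1
  ext y
  simp [mul_add]

lemma TT_smul {u₀ : EE → ℝ} (G : 𝓢(EE, ℝ)) (p : EE × ℝ) (c : ℝ) :
    TT volume u₀ (c • G) p = c * TT volume u₀ G p := by
  unfold TT
  rw [← integral_const_mul]
  congr 1
  ext y
  simp
  ring

lemma lap_TT {u₀ : EE → ℝ} (hc : Continuous u₀) {M : ℝ} (hM : ∀ x, |u₀ x| ≤ M)
    (G : 𝓢(EE, ℝ)) {l : ℝ} (hl : 0 < l) (c : ℝ) :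
    lap n (fun x => c * TT volume u₀ G (x, l)) =
      fun x => (c * l ^ 2) * TT volume u₀ (lapS G) (x, l) := by
  ext x
  unfold lap lapS
  rw [TT_sum hc hM _ x hl, Finset.mul_sum]
  refine Finset.sum_congr rfl fun i _ => ?_
  rw [pd_TT hc hM G hl, pd_TT hc hM _ hl]
  ring

lemma lap_iter_TT {u₀ : EE → ℝ} (hc : Continuous u₀) {M : ℝ} (hM : ∀ x, |u₀ x| ≤ M)
    {l : ℝ} (hl : 0 < l) (k : ℕ) : ∀ (c : ℝ) (G : 𝓢(EE, ℝ)),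
    (lap n)^[k] (fun x => c * TT volume u₀ G (x, l)) =
      fun x => (c * l ^ (2 * k)) * TT volume u₀ (lapS^[k] G) (x, l) := by
  induction k with
  | zero => intro c G; simp
  | succ k ih =>
    intro c G
    rw [Function.iterate_succ_apply, lap_TT hc hM G hl, ih, Function.iterate_succ_apply]
    ext x
    ring

lemma qq_temperate (k : ℕ) : (fun ξ : EE => (-((2 * π) ^ 2 * ‖ξ‖ ^ 2)) ^ k).HasTemperateGrowth := by
  have h : (fun x : EE => ‖x‖ ^ 2).HasTemperateGrowth := Function.hasTemperateGrowth_norm_sq EE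
  have h2 : (fun x : EE => (2 * π) ^ 2 * ‖x‖ ^ 2).HasTemperateGrowth :=
    (Function.HasTemperateGrowth.const _).mul h
  exact h2.neg.pow k

lemma fourier_sumS (f : Fin n → 𝓢(EE, ℂ)) : 𝓕 (∑ i, f i) = ∑ i, 𝓕 (f i) := by
  have := map_sum (FourierTransform.fourierCLM ℂ 𝓢(EE, ℂ)) f Finset.univ
  simpa using this

lemma inner_single_one (x : EE) (i : Fin n) :
    inner ℝ x (EuclideanSpace.single i (1:ℝ)) = x i := by
  simp [EuclideanSpace.inner_single_right]

lemma lapS_fourier (f : 𝓢(EE, ℂ)) : lapS (𝓕 f) =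
    𝓕 (SchwartzMap.smulLeftCLM ℂ (fun ξ : EE => (-((2 * π) ^ 2 * ‖ξ‖ ^ 2)) ^ 1) f) := by
  unfold lapS
  simp_rw [SchwartzMap.lineDerivOp_fourier_eq]
  rw [← fourier_sumS]
  congr 1
  ext ξ
  rw [SchwartzMap.smulLeftCLM_apply_apply (qq_temperate 1), sum_apply]
  have ht : ∀ i : Fin n, (fun x : EE => inner ℝ x (EuclideanSpace.single i (1:ℝ))).HasTemperateGrowth :=
    fun i => by fun_prop
  have : ∀ i : Fin n, (-(2 * π * Complex.I) • (SchwartzMap.smulLeftCLM ℂ fun x : EE => inner ℝ x (EuclideanSpace.single i (1:ℝ)))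
      (-(2 * π * Complex.I) • (SchwartzMap.smulLeftCLM ℂ fun x : EE => inner ℝ x (EuclideanSpace.single i (1:ℝ))) f)) ξ
      = -((2 * π) ^ 2) * ((ξ i) ^ 2 : ℝ) * f ξ := by
    intro i
    rw [smul_apply, SchwartzMap.smulLeftCLM_apply_apply (ht i), smul_apply,
      SchwartzMap.smulLeftCLM_apply_apply (ht i)]
    rw [inner_single_one]
    simp
    ring_nf
    simp
  simp_rw [this]
  rw [← Finset.sum_mul, ← Finset.mul_sum, EuclideanSpace.norm_sq_eq]
  simp

lemma lapS_iter_fourier (k : ℕ) : ∀ f : 𝓢(EE, ℂ), lapS^[k] (𝓕 f) =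
    𝓕 (SchwartzMap.smulLeftCLM ℂ (fun ξ : EE => (-((2 * π) ^ 2 * ‖ξ‖ ^ 2)) ^ k) f) := by
  induction k with
  | zero =>
    intro f
    simp
  | succ k ih =>
    intro f
    rw [Function.iterate_succ_apply, lapS_fourier, ih]
    congr 1
    ext ξ
    rw [SchwartzMap.smulLeftCLM_apply_apply (qq_temperate k),
      SchwartzMap.smulLeftCLM_apply_apply (qq_temperate 1),
      SchwartzMap.smulLeftCLM_apply_apply (qq_temperate (k + 1)), smul_smul, ← pow_add]

lemma D2_eq_sum {F : Type} [NormedAddCommGroup F] [NormedSpace ℝ F] (f : 𝓢(EE, F)) (x : EE) :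
    D2 f x = ∑ i, x i • ∂_{(EuclideanSpace.single i (1 : ℝ) : EE)} f x := by
  rw [D2_apply]
  simp_rw [SchwartzMap.lineDerivOp_apply_eq_fderiv]
  generalize fderiv ℝ f x = L
  have hx : x = ∑ i, x i • (EuclideanSpace.single i (1 : ℝ) : EE) := by
    conv_lhs => rw [← (EuclideanSpace.basisFun (Fin n) ℝ).sum_repr x]
    simp
  conv_lhs => rw [hx]
  rw [map_sum]
  simp only [map_smul]

lemma fourier_D2 (f : 𝓢(EE, ℂ)) : 𝓕 (D2 f) = -((n : ℂ) • 𝓕 f + D2 (𝓕 f)) := by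
  have ht : ∀ i : Fin n, (fun x : EE => inner ℝ x (EuclideanSpace.single i (1:ℝ))).HasTemperateGrowth :=
    fun i => by fun_prop
  have h1 : D2 f = ∑ i, (∂_{(EuclideanSpace.single i (1 : ℝ) : EE)}
      (SchwartzMap.smulLeftCLM ℂ (fun x : EE => inner ℝ x (EuclideanSpace.single i (1:ℝ))) f) - f) := by
    ext x
    rw [D2_eq_sum, sum_apply]
    refine Finset.sum_congr rfl fun i _ => ?_
    rw [sub_apply]
    simp only [SchwartzMap.lineDerivOp_apply_eq_fderiv]
    have hfun : ((SchwartzMap.smulLeftCLM ℂ (fun x : EE => inner ℝ x (EuclideanSpace.single i (1:ℝ)))) f : EE → ℂ)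
        = fun y : EE => (EuclideanSpace.proj (𝕜 := ℝ) i : EE →L[ℝ] ℝ) y • f y := by
      ext y
      rw [SchwartzMap.smulLeftCLM_apply_apply (ht i), inner_single_one]
      rfl
    rw [hfun, fderiv_fun_smul (ContinuousLinearMap.differentiableAt _) f.differentiableAt,
      ContinuousLinearMap.fderiv]
    simp
  rw [h1, fourier_sumS]
  ext x
  rw [sum_apply, neg_apply, add_apply, D2_eq_sum, smul_apply]
  have h2 : ∀ i : Fin n, (𝓕 (∂_{(EuclideanSpace.single i (1 : ℝ) : EE)}
      (SchwartzMap.smulLeftCLM ℂ (fun x : EE => inner ℝ x (EuclideanSpace.single i (1:ℝ))) f) - f)) x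
      = - (x i • (∂_{(EuclideanSpace.single i (1 : ℝ) : EE)} (𝓕 f)) x) - 𝓕 f x := by
    intro i
    rw [sub_eq_add_neg, FourierTransform.fourier_add, FourierTransform.fourier_neg, ← sub_eq_add_neg, sub_apply, SchwartzMap.fourier_lineDerivOp_eq, SchwartzMap.lineDerivOp_fourier_eq,
      FourierTransform.fourier_smul, smul_apply, smul_apply,
      SchwartzMap.smulLeftCLM_apply_apply (ht i), inner_single_one]
    simp
    ring
  simp_rw [h2]
  simp
  ring

end PartC


section PartC2
variable {n : ℕ}

local notation "EE" => EuclideanSpace ℝ (Fin n)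

noncomputable def reS (f : 𝓢(EE, ℂ)) : 𝓢(EE, ℝ) := f.postcompCLM Complex.reCLM

lemma reS_apply (f : 𝓢(EE, ℂ)) (x : EE) : reS f x = (f x).re := rfl

lemma reS_fderiv (f : 𝓢(EE, ℂ)) (x v : EE) : fderiv ℝ (reS f) x v = (fderiv ℝ f x v).re := by
  have h : HasFDerivAt (fun y => Complex.reCLM (f y)) (Complex.reCLM.comp (fderiv ℝ f x)) x :=
    Complex.reCLM.hasFDerivAt.comp x f.differentiableAt.hasFDerivAt
  have h2 : (reS f : EE → ℝ) = fun y => Complex.reCLM (f y) := rfl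
  rw [h2, h.fderiv]
  rfl

lemma reS_line (f : 𝓢(EE, ℂ)) (v : EE) : ∂_{v} (reS f) = reS (∂_{v} f) := by
  ext x
  rw [SchwartzMap.lineDerivOp_apply_eq_fderiv, reS_fderiv, reS_apply, SchwartzMap.lineDerivOp_apply_eq_fderiv]

lemma reS_lapS (f : 𝓢(EE, ℂ)) : lapS (reS f) = reS (lapS f) := by
  unfold lapS
  simp_rw [reS_line]
  ext x
  simp [reS_apply, sum_apply]

lemma reS_lapS_iter (k : ℕ) : ∀ f : 𝓢(EE, ℂ), lapS^[k] (reS f) = reS (lapS^[k] f) := by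
  induction k with
  | zero => intro f; rfl
  | succ k ih =>
    intro f
    rw [Function.iterate_succ_apply, reS_lapS, ih, Function.iterate_succ_apply]

lemma reS_D2 (f : 𝓢(EE, ℂ)) : D2 (reS f) = reS (D2 f) := by
  ext x
  rw [D2_apply, reS_fderiv, reS_apply, D2_apply]

lemma D2_gC (m : ℕ) (hm : 1 ≤ m) : D2 (gC EE m hm) =
    (-(2 * m * (-1) ^ m) : ℂ) • (SchwartzMap.smulLeftCLM ℂ (fun ξ : EE => (-((2 * π) ^ 2 * ‖ξ‖ ^ 2)) ^ m)
      (gC EE m hm)) := by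
  ext x
  rw [D2_apply, smul_apply, SchwartzMap.smulLeftCLM_apply_apply (qq_temperate m)]
  have h1 : HasDerivAt (fun s : ℝ => gC EE m hm (s • x)) (fderiv ℝ (gC EE m hm) x x) 1 := by
    have h0 : HasFDerivAt (gC EE m hm) (fderiv ℝ (gC EE m hm) x) ((1:ℝ) • x) := by
      rw [one_smul]; exact (gC EE m hm).differentiableAt.hasFDerivAt
    have h2 : HasDerivAt (fun s : ℝ => s • x) ((1:ℝ) • x) 1 := (hasDerivAt_id (1:ℝ)).smul_const x
    rw [one_smul] at h2
    exact h0.comp_hasDerivAt 1 h2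
  have h2 : HasDerivAt (fun s : ℝ => gC EE m hm (s • x))
      ((-(2 * m * qpoly m x * Real.exp (-qpoly m x)) : ℝ) : ℂ) 1 := by
    have h3 : HasDerivAt (fun s : ℝ => Real.exp (-(qpoly m x * s ^ (2 * m))))
        (-(2 * m * qpoly m x * Real.exp (-qpoly m x))) 1 := by
      have := (((hasDerivAt_pow (2 * m) (1:ℝ)).const_mul (qpoly m x)).neg).exp
      refine this.congr_deriv ?_
      push_cast
      simp
      ring
    refine h3.ofReal_comp.congr_of_eventuallyEq ?_
    refine Eventually.of_forall fun s => ?_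
    dsimp only
    rw [gC_apply]
    push_cast
    congr 2
    unfold qpoly
    rw [norm_smul]
    push_cast
    have : ((‖s‖ : ℝ) : ℂ) ^ 2 = (s:ℂ) ^ 2 := by
      rw [← Complex.ofReal_pow, Real.norm_eq_abs, sq_abs, Complex.ofReal_pow]
    rw [mul_pow (‖s‖ : ℂ), this, pow_mul]
    simp only [mul_pow]
    ring
  rw [h1.unique h2, gC_apply]
  unfold qpoly
  push_cast
  simp only [Complex.real_smul, smul_eq_mul]
  push_cast
  rw [neg_pow ((2 * (π:ℂ)) ^ 2 * _)]
  have : ((-1:ℂ) ^ m) * (-1) ^ m = 1 := by rw [← mul_pow]; simp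
  linear_combination (2 * (m:ℂ) * ((2 * (π:ℂ)) ^ 2 * (‖x‖:ℂ) ^ 2) ^ m * Complex.exp (-((2 * (π:ℂ)) ^ 2 * (‖x‖:ℂ) ^ 2) ^ m)) * this

noncomputable def HR (n m : ℕ) (hm : 1 ≤ m) : 𝓢(EuclideanSpace ℝ (Fin n), ℝ) :=
  reS (𝓕 (gC (EuclideanSpace ℝ (Fin n)) m hm))

lemma HR_identity (m : ℕ) (hm : 1 ≤ m) :
    (n : ℝ) • HR n m hm + D2 (HR n m hm) = (2 * m * (-1) ^ m : ℝ) • lapS^[m] (HR n m hm) := by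
  unfold HR
  rw [reS_lapS_iter, reS_D2, lapS_iter_fourier]
  have h := fourier_D2 (gC EE m hm)
  rw [D2_gC, FourierTransform.fourier_smul] at h
  ext x
  have h' := congrArg (fun F : 𝓢(EE, ℂ) => (F x).re) h
  simp only [add_apply, smul_apply, neg_apply, smul_eq_mul, reS_apply] at h' ⊢
  have e : (-(2 * m * (-1) ^ m) : ℂ) = ((-(2 * m * (-1) ^ m) : ℝ) : ℂ) := by push_cast; rfl
  have e2 : (n : ℂ) = ((n : ℝ) : ℂ) := by push_cast; rfl
  rw [e, e2, Complex.re_ofReal_mul, Complex.neg_re, Complex.add_re, Complex.re_ofReal_mul] at h'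
  linarith

lemma HR_integral (m : ℕ) (hm : 1 ≤ m) : ∫ x, HR n m hm x = 1 := by
  have h1 : (𝓕⁻ (𝓕 (gC EE m hm))) 0 = gC EE m hm 0 := by simp
  rw [SchwartzMap.fourierInv_coe, Real.fourierInv_eq] at h1
  simp only [inner_zero_right, AddChar.map_zero_eq_one, one_smul] at h1
  have h2 : ∫ x, (HR n m hm x) = (∫ x, 𝓕 (gC EE m hm) x).re := by
    rw [← Complex.reCLM_apply, ← Complex.reCLM.integral_comp_comm (SchwartzMap.integrable _)]
    rfl
  rw [h2, h1, gC_apply]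
  simp [qpoly, show m ≠ 0 by omega]

lemma HR_apply (m : ℕ) (hm : 1 ≤ m) (x : EE) :
    HR n m hm x = ∫ ξ : EE, Real.cos (2 * π * inner ℝ x ξ) * Real.exp (-qpoly m ξ) := by
  unfold HR
  rw [reS_apply, SchwartzMap.fourier_coe, Real.fourier_eq', ← Complex.reCLM_apply,
    ← Complex.reCLM.integral_comp_comm]
  · congr 1
    ext ξ
    rw [gC_apply, Complex.reCLM_apply, smul_eq_mul, ← Complex.ofReal_neg (qpoly m ξ),
      ← Complex.ofReal_exp, Complex.re_mul_ofReal, Complex.exp_ofReal_mul_I_re, real_inner_comm]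
    congr 1
    rw [← Real.cos_neg]
    congr 1
    ring
  · have := (Real.fourierIntegral_convergent_iff (μ := volume) (f := gC EE m hm) x).2 (SchwartzMap.integrable _)
    refine this.congr (Eventually.of_forall fun ξ => ?_)
    simp [Circle.smul_def, Real.fourierChar_apply]

end PartC2


section PartD
variable {n : ℕ}

local notation "EE" => EuclideanSpace ℝ (Fin n)

lemma polar_integral [Nontrivial EE] {h : EE → ℝ} (hh : Integrable h) :
    ∫ x, h x = ∫ r in Set.Ioi (0:ℝ), r ^ (n - 1) *
      ∫ w : Metric.sphere (0 : EE) 1, h (r • (w : EE)) ∂(volume : Measure EE).toSphere := by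
  have hdim : Module.finrank ℝ EE = n := by simp
  set g : Metric.sphere (0 : EE) 1 × Set.Ioi (0:ℝ) → ℝ := fun p => h ((p.2 : ℝ) • (p.1 : EE)) with hg
  have hgx : ∀ x : ({0}ᶜ : Set EE), g (homeomorphUnitSphereProd EE x) = h x := by
    intro x
    have hx : ‖(x : EE)‖ ≠ 0 := norm_ne_zero_iff.2 x.2
    simp only [hg, homeomorphUnitSphereProd_apply_snd_coe, homeomorphUnitSphereProd_apply_fst_coe]
    rw [smul_smul, mul_inv_cancel₀ hx, one_smul]
  have h1 : ∫ x, h x = ∫ x : ({(0)}ᶜ : Set EE), h x ∂((volume : Measure EE).comap (↑)) := by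
    rw [integral_subtype_comap (measurableSet_singleton _).compl fun x ↦ h x, restrict_compl_singleton]
  have mp := (volume : Measure EE).measurePreserving_homeomorphUnitSphereProd
  have h2 := mp.integral_comp (Homeomorph.measurableEmbedding _) g
  simp_rw [hgx] at h2
  have hgi : Integrable g ((volume : Measure EE).toSphere.prod (.volumeIoiPow (Module.finrank ℝ EE - 1))) := by
    rw [← mp.integrable_comp_emb (Homeomorph.measurableEmbedding _)]
    have h3 : g ∘ (homeomorphUnitSphereProd EE) = h ∘ Subtype.val := funext hgx
    rw [h3, ← integrableOn_iff_comap_subtypeVal (measurableSet_singleton _).compl]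
    exact hh.integrableOn
  rw [h1, h2, integral_prod_symm _ hgi]
  simp only [Measure.volumeIoiPow, ENNReal.ofReal]
  rw [integral_withDensity_eq_integral_smul, hdim]
  · simp only [hg]
    rw [integral_subtype_comap measurableSet_Ioi fun a : ℝ ↦ Real.toNNReal (a ^ (n - 1)) •
      ∫ w : Metric.sphere (0 : EE) 1, h (a • (w : EE)) ∂(volume : Measure EE).toSphere]
    refine setIntegral_congr_fun measurableSet_Ioi fun x hx ↦ ?_
    simp only [NNReal.smul_def, Real.coe_toNNReal _ (pow_nonneg (le_of_lt hx) _), smul_eq_mul]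
  · exact (measurable_subtype_coe.pow_const _).real_toNNReal

lemma int_1d (k : ℕ) : ∫ t : ℝ, t ^ (2 * k) * Real.exp (-t ^ 2) = Real.Gamma (k + 1 / 2) := by
  have h := integral_comp_abs (f := fun t : ℝ => t ^ (2 * k) * Real.exp (-t ^ 2))
  have e : ∀ t : ℝ, |t| ^ (2 * k) = t ^ (2 * k) := fun t => by rw [pow_mul, sq_abs, pow_mul]
  simp only [e, sq_abs] at h
  rw [h]
  have h2 := integral_rpow_mul_exp_neg_rpow (p := 2) (q := (2 * k : ℕ)) (by norm_num) (by
    have : (0:ℝ) ≤ (2 * k : ℕ) := by positivity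
    linarith)
  simp only [Real.rpow_natCast, Real.rpow_two] at h2
  rw [h2, ← mul_assoc]
  push_cast
  norm_num
  congr 1
  ring

lemma intble_1d (k : ℕ) : Integrable (fun t : ℝ => t ^ (2 * k) * Real.exp (-t ^ 2)) := by
  have h2 := integrable_rpow_mul_exp_neg_mul_sq (b := 1) (s := (2 * k : ℕ)) (by norm_num) (by
    have : (0:ℝ) ≤ (2 * k : ℕ) := by positivity
    linarith)
  simpa only [Real.rpow_natCast, neg_mul, one_mul] using h2

lemma int_radial (hn : 1 ≤ n) (k : ℕ) :
    ∫ t in Set.Ioi (0:ℝ), t ^ (n - 1) * (t ^ (2 * k) * Real.exp (-t ^ 2)) = Real.Gamma (k + n / 2) / 2 := by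
  have h2 := integral_rpow_mul_exp_neg_rpow (p := 2) (q := (n - 1 + 2 * k : ℕ)) (by norm_num) (by
    have : (0:ℝ) ≤ (n - 1 + 2 * k : ℕ) := by positivity
    linarith)
  simp only [Real.rpow_natCast, Real.rpow_two] at h2
  simp_rw [← mul_assoc, ← pow_add]
  rw [h2]
  push_cast [Nat.cast_sub hn]
  rw [one_div, inv_mul_eq_div]
  congr 2
  ring

lemma gamma_half (k : ℕ) : Real.Gamma (k + 1 / 2) = (2 * k).factorial * √π / (4 ^ k * k.factorial) := by
  induction k with
  | zero => simp [Real.Gamma_one_half_eq, -one_div]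
  | succ k ih =>
    have : ((k + 1 : ℕ) : ℝ) + 1 / 2 = (k + 1 / 2) + 1 := by push_cast; ring
    rw [this, Real.Gamma_add_one (by positivity), ih, show 2 * (k + 1) = 2 * k + 1 + 1 by ring,
      Nat.factorial_succ, Nat.factorial_succ, Nat.factorial_succ]
    push_cast
    field_simp
    ring

/-- Gaussian moments in direction of a coordinate -/
lemma gauss_coord (i0 : Fin n) (k : ℕ) :
    Integrable (fun ξ : EE => (ξ i0) ^ (2 * k) * Real.exp (-‖ξ‖ ^ 2)) ∧
    ∫ ξ : EE, (ξ i0) ^ (2 * k) * Real.exp (-‖ξ‖ ^ 2) = Real.Gamma (k + 1 / 2) * √π ^ (n - 1) := by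
  set f : Fin n → ℝ → ℝ := fun i t => t ^ (2 * (if i = i0 then k else 0)) * Real.exp (-t ^ 2) with hf
  have hprod : ∀ y : Fin n → ℝ, ∏ i, f i (y i) =
      (fun ξ : EE => (ξ i0) ^ (2 * k) * Real.exp (-‖ξ‖ ^ 2)) (WithLp.toLp 2 y) := by
    intro y
    simp only [hf, Finset.prod_mul_distrib, ← Real.exp_sum, EuclideanSpace.norm_sq_eq]
    congr 1
    · rw [Finset.prod_eq_single i0] <;> simp +contextual
    · simp
  have mp := PiLp.volume_preserving_toLp (Fin n)
  have me := (MeasurableEquiv.toLp 2 (Fin n → ℝ)).measurableEmbedding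
  constructor
  · rw [← mp.integrable_comp_emb me]
    have := Integrable.fintype_prod (f := f) (μ := fun _ => (volume : Measure ℝ)) (fun i => intble_1d _)
    refine this.congr (Eventually.of_forall fun y => hprod y)
  · rw [← mp.integral_comp me]
    rw [← integral_congr_ae (Eventually.of_forall fun y => hprod y)]
    rw [integral_fintype_prod_volume_eq_prod]
    simp only [hf, int_1d]
    rw [← Finset.mul_prod_erase _ _ (Finset.mem_univ i0)]
    simp only [if_true]
    congr 1
    rw [Finset.prod_congr rfl (g := fun _ => √π)]
    · simp
    · intro i hi
      rw [if_neg (Finset.ne_of_mem_erase hi)]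
      simp [Real.Gamma_one_half_eq, -one_div]

lemma gauss_moment (i0 : Fin n) (k : ℕ) (x : EE) (hx : x ≠ 0) :
    Integrable (fun ξ : EE => (inner ℝ x ξ) ^ (2 * k) * Real.exp (-‖ξ‖ ^ 2)) ∧
    ∫ ξ : EE, (inner ℝ x ξ) ^ (2 * k) * Real.exp (-‖ξ‖ ^ 2) =
      ‖x‖ ^ (2 * k) * (Real.Gamma (k + 1 / 2) * √π ^ (n - 1)) := by
  have hx' : ‖x‖ ≠ 0 := norm_ne_zero_iff.2 hx
  obtain ⟨b, hb⟩ : ∃ b : OrthonormalBasis (Fin n) ℝ EE, ∀ i ∈ ({i0} : Set (Fin n)), b i = ‖x‖⁻¹ • x := by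
    refine Orthonormal.exists_orthonormalBasis_extension_of_card_eq (by simp) (v := fun _ => ‖x‖⁻¹ • x) ?_
    rw [orthonormal_iff_ite]
    rintro ⟨i, hi⟩ ⟨j, hj⟩
    simp only [Set.mem_singleton_iff] at hi hj
    subst hi hj
    simp only [Set.domRestrict, if_true, real_inner_self_eq_norm_sq, norm_smul, norm_inv, norm_norm]
    rw [inv_mul_cancel₀ hx', one_pow]
  have hb0 : b i0 = ‖x‖⁻¹ • x := hb i0 rfl
  have mp := b.repr.measurePreserving
  have me : MeasurableEmbedding b.repr := b.repr.toHomeomorph.measurableEmbedding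
  have hpt : ∀ ξ : EE, (inner ℝ x ξ) ^ (2 * k) * Real.exp (-‖ξ‖ ^ 2) =
      ‖x‖ ^ (2 * k) * ((b.repr ξ i0) ^ (2 * k) * Real.exp (-‖b.repr ξ‖ ^ 2)) := by
    intro ξ
    rw [LinearIsometryEquiv.norm_map, OrthonormalBasis.repr_apply_apply, hb0, inner_smul_left, ← mul_assoc, ← mul_pow]
    congr 2
    simp
    field_simp
  obtain ⟨h1, h2⟩ := gauss_coord i0 k
  simp_rw [hpt]
  constructor
  · refine Integrable.const_mul ?_ _
    exact (mp.integrable_comp_emb me).2 h1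
  · rw [integral_const_mul, ← h2]
    congr 1
    exact mp.integral_comp me (fun ξ : EE => (ξ i0) ^ (2 * k) * Real.exp (-‖ξ‖ ^ 2))

lemma nontriv_EE (hn : 1 ≤ n) : Nontrivial EE := by
  have : Nonempty (Fin n) := ⟨⟨0, hn⟩⟩
  infer_instance

lemma sphere_moment (hn : 1 ≤ n) (k : ℕ) (x : EE) (hx : x ≠ 0) :
    ∫ w : Metric.sphere (0 : EE) 1, (inner ℝ x (w : EE)) ^ (2 * k) ∂(volume : Measure EE).toSphere =
      2 * π ^ ((n : ℝ) / 2) * (2 * k).factorial / (4 ^ k * k.factorial * Real.Gamma (k + n / 2)) * ‖x‖ ^ (2 * k) := by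
  have := nontriv_EE hn
  obtain ⟨h1, h2⟩ := gauss_moment ⟨0, hn⟩ k x hx
  rw [polar_integral h1] at h2
  have h3 : ∀ r ∈ Set.Ioi (0:ℝ), r ^ (n - 1) *
      ∫ w : Metric.sphere (0 : EE) 1, (inner ℝ x (r • (w : EE))) ^ (2 * k) * Real.exp (-‖r • (w : EE)‖ ^ 2)
        ∂(volume : Measure EE).toSphere =
      (r ^ (n - 1) * (r ^ (2 * k) * Real.exp (-r ^ 2))) *
        ∫ w : Metric.sphere (0 : EE) 1, (inner ℝ x (w : EE)) ^ (2 * k) ∂(volume : Measure EE).toSphere := by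
    intro r hr
    have h4 : ∀ w : Metric.sphere (0 : EE) 1,
        (inner ℝ x (r • (w : EE))) ^ (2 * k) * Real.exp (-‖r • (w : EE)‖ ^ 2) =
        (r ^ (2 * k) * Real.exp (-r ^ 2)) * (inner ℝ x (w : EE)) ^ (2 * k) := by
      intro w
      rw [inner_smul_right, norm_smul]
      simp
      ring
    simp_rw [h4]
    rw [integral_const_mul]
    ring
  rw [setIntegral_congr_fun measurableSet_Ioi h3, integral_mul_const, int_radial hn, gamma_half] at h2
  have hG : Real.Gamma (k + n / 2) ≠ 0 := (Real.Gamma_pos_of_pos (by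
    have : (0:ℝ) < n := by exact_mod_cast hn
    positivity)).ne'
  have hpi : π ^ ((n:ℝ) / 2) = √π * √π ^ (n - 1) := by
    rw [← pow_succ', Nat.sub_add_cancel hn, Real.sqrt_eq_rpow, ← Real.rpow_natCast, ← Real.rpow_mul pi_pos.le]
    congr 1
    ring
  rw [hpi]
  field_simp at h2 ⊢
  linarith

end PartD


section PartD2
variable {n : ℕ}

local notation "EE" => EuclideanSpace ℝ (Fin n)

noncomputable def PhiB (n : ℕ) (z : ℝ) : ℝ :=
  ∑' k : ℕ, (-1 : ℝ) ^ k * (z / 2) ^ (2 * k) / (k.factorial * Real.Gamma (k + (n : ℝ) / 2))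

lemma sphere_cos (hn : 1 ≤ n) (x : EE) (hx : x ≠ 0) (z : ℝ) :
    ∫ w : Metric.sphere (0 : EE) 1, Real.cos (z * inner ℝ x (w : EE)) ∂(volume : Measure EE).toSphere =
      2 * π ^ ((n : ℝ) / 2) * PhiB n (z * ‖x‖) := by
  have hG : ∀ k : ℕ, Real.Gamma (k + (n:ℝ) / 2) ≠ 0 := fun k => (Real.Gamma_pos_of_pos (by
    have : (0:ℝ) < n := by exact_mod_cast hn
    positivity)).ne'
  have key := hasSum_integral_of_dominated_convergence (μ := (volume : Measure EE).toSphere)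
    (F := fun (k : ℕ) (w : Metric.sphere (0 : EE) 1) =>
      (-1 : ℝ) ^ k * (z * inner ℝ x (w : EE)) ^ (2 * k) / ((2 * k).factorial : ℝ))
    (f := fun w => Real.cos (z * inner ℝ x (w : EE)))
    (fun k _ => (z * ‖x‖) ^ (2 * k) / ((2 * k).factorial : ℝ))
    (fun k => by
      apply Continuous.aestronglyMeasurable
      fun_prop)
    (fun k => Eventually.of_forall fun w => by
      rw [norm_div, norm_mul, norm_pow, norm_neg, norm_one, one_pow, one_mul, Real.norm_natCast]
      gcongr
      rw [Real.norm_eq_abs, abs_of_nonneg (by rw [pow_mul]; positivity), pow_mul, pow_mul]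
      have h1 : |inner ℝ x (w : EE)| ≤ ‖x‖ := by
        have := abs_real_inner_le_norm x (w : EE)
        simpa using this
      have h2 : (inner ℝ x (w : EE)) ^ 2 ≤ ‖x‖ ^ 2 := by
        rw [← sq_abs]; gcongr
      rw [mul_pow z (inner ℝ x (w : EE)), mul_pow z ‖x‖]
      gcongr)
    (Eventually.of_forall fun w => (Real.hasSum_cosh (z * ‖x‖)).summable)
    (by simp)
    (Eventually.of_forall fun w => Real.hasSum_cos _)
  rw [← key.tsum_eq, PhiB, ← tsum_mul_left]
  congr 1
  ext k
  have e : ∀ w : Metric.sphere (0 : EE) 1, (-1 : ℝ) ^ k * (z * inner ℝ x (w : EE)) ^ (2 * k) / ((2 * k).factorial : ℝ)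
      = ((-1 : ℝ) ^ k * z ^ (2 * k) / ((2 * k).factorial : ℝ)) * (inner ℝ x (w : EE)) ^ (2 * k) := by
    intro w; rw [mul_pow]; ring
  simp_rw [e]
  rw [integral_const_mul, sphere_moment hn k x hx, div_pow, mul_pow, pow_mul 2 2 k]
  have := hG k
  norm_num
  field_simp

noncomputable def gB (m n : ℕ) (η s : ℝ) : ℝ := s ^ (n - 1) * Real.exp (-(s ^ (2 * m))) * PhiB n (η * s)

lemma HR_radial (hn : 1 ≤ n) (m : ℕ) (hm : 1 ≤ m) (x : EE) (hx : x ≠ 0) :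
    HR n m hm x = 2 * π ^ ((n : ℝ) / 2) * ((2 * π) ^ n)⁻¹ * ∫ s in Set.Ioi (0:ℝ), gB m n ‖x‖ s := by
  have := nontriv_EE hn
  have hintg : Integrable (fun ξ : EE => Real.cos (2 * π * inner ℝ x ξ) * Real.exp (-qpoly m ξ)) := by
    have h1 : Integrable (fun ξ : EE => gS EE m hm ξ) := (gS EE m hm).integrable
    refine h1.mono' ?_ (Eventually.of_forall fun ξ => ?_)
    · apply Continuous.aestronglyMeasurable
      have : Continuous (fun ξ : EE => qpoly m ξ) := by unfold qpoly; fun_prop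
      fun_prop
    · rw [gS_apply, norm_mul, Real.norm_eq_abs, Real.norm_eq_abs, abs_of_pos (Real.exp_pos _)]
      have := Real.abs_cos_le_one (2 * π * inner ℝ x ξ)
      nlinarith [Real.exp_pos (-qpoly m ξ)]
  rw [HR_apply, polar_integral hintg]
  have h3 : ∀ r ∈ Set.Ioi (0:ℝ), r ^ (n - 1) *
      ∫ w : Metric.sphere (0 : EE) 1, Real.cos (2 * π * inner ℝ x (r • (w : EE))) * Real.exp (-qpoly m (r • (w : EE)))
        ∂(volume : Measure EE).toSphere =
      (2 * π ^ ((n : ℝ) / 2) * ((2 * π) ^ (n - 1))⁻¹) * gB m n ‖x‖ (2 * π * r) := by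
    intro r hr
    have h4 : ∀ w : Metric.sphere (0 : EE) 1, Real.cos (2 * π * inner ℝ x (r • (w : EE))) * Real.exp (-qpoly m (r • (w : EE)))
        = Real.exp (-((2 * π * r) ^ (2 * m))) * Real.cos ((2 * π * r) * inner ℝ x (w : EE)) := by
      intro w
      rw [mul_comm, inner_smul_right]
      congr 2
      · unfold qpoly
        rw [norm_smul, pow_mul]
        simp [mul_pow]
      · ring
    simp_rw [h4]
    rw [integral_const_mul, sphere_cos hn x hx, gB, mul_pow (2 * π) r (n - 1), mul_comm (2 * π * r) ‖x‖]
    have : ((2 * π) ^ (n - 1)) ≠ 0 := by positivity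
    field_simp
  rw [setIntegral_congr_fun measurableSet_Ioi h3, integral_const_mul,
    integral_comp_mul_left_Ioi (fun s => gB m n ‖x‖ s) 0 (by positivity), mul_zero, smul_eq_mul, ← mul_assoc]
  congr 1
  rw [mul_assoc, ← mul_inv, ← pow_succ, Nat.sub_add_cancel hn]

lemma bessel_phi (hn : 1 ≤ n) {y : ℝ} (hy : 0 < y) :
    y ^ ((n : ℝ) / 2) * besselJ (((n : ℝ) - 2) / 2) y =
      (2 : ℝ) ^ (1 - (n : ℝ) / 2) * y ^ (n - 1) * PhiB n y := by
  unfold besselJ PhiB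
  rw [← tsum_mul_left, ← tsum_mul_left]
  congr 1
  ext k
  have e1 : (k : ℝ) + ((n : ℝ) - 2) / 2 + 1 = k + (n : ℝ) / 2 := by ring
  have e2 : y ^ ((n : ℝ) / 2) * (y / 2) ^ ((2 * k : ℝ) + ((n : ℝ) - 2) / 2) =
      (2 : ℝ) ^ (1 - (n : ℝ) / 2) * y ^ (n - 1) * (y / 2) ^ (2 * k) := by
    have e3 : (2 * k : ℝ) = ((2 * k : ℕ) : ℝ) := by push_cast; rfl
    rw [Real.rpow_add (by positivity), e3, Real.rpow_natCast, Real.div_rpow hy.le (by norm_num),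
      ← Real.rpow_natCast y (n - 1), Nat.cast_sub hn,
      show (1 - (n:ℝ) / 2) = - (((n:ℝ) - 2) / 2) by ring, Real.rpow_neg (by norm_num),
      show ((n:ℝ) - (1 : ℕ)) = (n : ℝ) / 2 + ((n:ℝ) - 2) / 2 by push_cast; ring, Real.rpow_add hy]
    ring
  rw [e1]
  rw [show ∀ a b c d : ℝ, a * (b * c / d) = b * (a * c) / d from fun a b c d => by ring, e2]
  ring

lemma fmn_eq (hn : 1 ≤ n) (m : ℕ) (hm : 1 ≤ m) (x : EE) (hx : x ≠ 0) :
    fmn m n ‖x‖ = (2 * π) ^ ((n : ℝ) / 2) * HR n m hm x := by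
  have hη : 0 < ‖x‖ := norm_pos_iff.2 hx
  rw [HR_radial hn m hm x hx]
  unfold fmn
  have h1 : ∀ s ∈ Set.Ioi (0:ℝ), Real.exp (-(s ^ (2 * m))) * (‖x‖ * s) ^ ((n : ℝ) / 2) *
        besselJ (((n : ℝ) - 2) / 2) (‖x‖ * s) =
      ((2 : ℝ) ^ (1 - (n : ℝ) / 2) * ‖x‖ ^ (n - 1)) * gB m n ‖x‖ s := by
    intro s hs
    rw [mul_assoc, bessel_phi hn (mul_pos hη hs), gB, mul_pow]
    ring
  rw [setIntegral_congr_fun measurableSet_Ioi h1, integral_const_mul, ← mul_assoc, ← mul_assoc (_ ^ _)]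
  rw [← mul_assoc ((2 * π) ^ ((n:ℝ) / 2))]
  congr 1
  have e1 : ‖x‖ ^ ((1:ℝ) - n) * ‖x‖ ^ (n - 1) = 1 := by
    rw [← Real.rpow_natCast, ← Real.rpow_add hη, Nat.cast_sub hn]
    simp
  have e2 : ((2 * π) ^ n)⁻¹ = (2 * π) ^ (-(n:ℝ)) := by
    rw [Real.rpow_neg (by positivity), Real.rpow_natCast]
  rw [mul_right_comm, e1, one_mul, e2,
    Real.mul_rpow (by norm_num) pi_pos.le, Real.mul_rpow (by norm_num) pi_pos.le, sub_eq_add_neg,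
    Real.rpow_add (by norm_num), Real.rpow_one]
  have e3 : π ^ ((n:ℝ) / 2) * π ^ ((n:ℝ) / 2) * π ^ (-(n:ℝ)) = 1 := by
    rw [← Real.rpow_add pi_pos, ← Real.rpow_add pi_pos]
    ring_nf
    simp
  have e4 : (2:ℝ) ^ ((n:ℝ) / 2) * 2 ^ (-(n:ℝ)) = 2 ^ (-((n:ℝ) / 2)) := by
    rw [← Real.rpow_add (by norm_num)]
    congr 1
    ring
  rw [← e4]
  linear_combination (- 2 * (2:ℝ) ^ ((n:ℝ) / 2) * 2 ^ (-(n:ℝ))) * e3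

end PartD2


section PartE
variable {n : ℕ}

local notation "EE" => EuclideanSpace ℝ (Fin n)

noncomputable def lsc (m : ℕ) (t : ℝ) : ℝ := t ^ (-(1 / (2 * m : ℝ)))

lemma lsc_pos (m : ℕ) {t : ℝ} (ht : 0 < t) : 0 < lsc m t := Real.rpow_pos_of_pos ht _

lemma lsc_inv (m : ℕ) {t : ℝ} (ht : 0 < t) : (lsc m t)⁻¹ = t ^ ((1 : ℝ) / (2 * m)) := by
  rw [lsc, Real.rpow_neg ht.le, inv_inv]

lemma lsc_pow_n (m n : ℕ) {t : ℝ} (ht : 0 < t) : (lsc m t) ^ n = t ^ (-(n : ℝ) / (2 * m)) := by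
  rw [lsc, ← Real.rpow_natCast, ← Real.rpow_mul ht.le]
  congr 1
  ring

lemma lsc_pow_2m (m : ℕ) (hm : 1 ≤ m) {t : ℝ} (ht : 0 < t) : (lsc m t) ^ (2 * m) = t⁻¹ := by
  have : (m : ℝ) ≠ 0 := by positivity
  rw [lsc, ← Real.rpow_natCast, ← Real.rpow_mul ht.le, ← Real.rpow_neg_one]
  congr 1
  push_cast
  field_simp

lemma lsc_hasDerivAt (m : ℕ) (hm : 1 ≤ m) {t : ℝ} (ht : 0 < t) :
    HasDerivAt (lsc m) (-(1 / (2 * m : ℝ)) * ((lsc m t) * (lsc m t) ^ (2 * m))) t := by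
  have := Real.hasDerivAt_rpow_const (x := t) (p := -(1 / (2 * m : ℝ))) (Or.inl ht.ne')
  refine this.congr_deriv ?_
  rw [lsc_pow_2m m hm ht, lsc, Real.rpow_sub ht, Real.rpow_one]
  rfl

lemma alpha_eq (hn : 1 ≤ n) (m : ℕ) (hm : 1 ≤ m) {α : ℝ} 
    (hαdef : α⁻¹ = ∫ x : EE, fmn m n ‖x‖) : α * (2 * π) ^ ((n : ℝ) / 2) = 1 := by
  have := nontriv_EE hn
  have h : ∫ x : EE, fmn m n ‖x‖ = ∫ x : EE, (2 * π) ^ ((n : ℝ) / 2) * HR n m hm x := by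
    refine integral_congr_ae ?_
    filter_upwards [compl_mem_ae_iff.2 (measure_singleton (0 : EE))] with x hx
    exact fmn_eq hn m hm x hx
  rw [h, integral_const_mul, HR_integral, mul_one] at hαdef
  rw [← hαdef]
  refine mul_inv_cancel₀ fun h0 => ?_
  rw [h0, inv_zero] at hαdef
  have : (0:ℝ) < (2 * π) ^ ((n : ℝ) / 2) := by positivity
  linarith

lemma TT_flip (u₀ : EE → ℝ) (G : 𝓢(EE, ℝ)) (x : EE) (l : ℝ) :
    TT volume u₀ G (x, l) = ∫ y, u₀ (x - y) * G (l • y) := by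
  unfold TT
  rw [← integral_sub_left_eq_self _ volume x]
  simp

lemma TT_scale (u₀ : EE → ℝ) (G : 𝓢(EE, ℝ)) (x : EE) {l : ℝ} (hl : 0 < l) :
    l ^ n * TT volume u₀ G (x, l) = ∫ z, u₀ (x - l⁻¹ • z) * G z := by
  rw [TT_flip]
  have h := Measure.integral_comp_smul volume (fun z : EE => u₀ (x - l⁻¹ • z) * G z) l
  simp only [smul_smul, inv_mul_cancel₀ hl.ne', one_smul, finrank_euclideanSpace_fin] at h
  rw [h, abs_of_pos (by positivity), smul_eq_mul, ← mul_assoc, mul_inv_cancel₀ (by positivity), one_mul]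

lemma u_formula (hn : 1 ≤ n) (m : ℕ) (hm : 1 ≤ m) {α : ℝ}
    (hαdef : α⁻¹ = ∫ x : EE, fmn m n ‖x‖) (u₀ : EE → ℝ) (x : EE) {t : ℝ} (ht : 0 < t) :
    α * t ^ (-(n : ℝ) / (2 * m)) *
        ∫ y : EE, u₀ (x - y) * fmn m n (‖y‖ / t ^ ((1 : ℝ) / (2 * m))) =
    (lsc m t) ^ n * TT volume u₀ (HR n m hm) (x, lsc m t) := by
  have := nontriv_EE hn
  have hl := lsc_pos m ht
  have h : ∫ y : EE, u₀ (x - y) * fmn m n (‖y‖ / t ^ ((1 : ℝ) / (2 * m))) =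
      ∫ y : EE, (2 * π) ^ ((n : ℝ) / 2) * (u₀ (x - y) * HR n m hm (lsc m t • y)) := by
    refine integral_congr_ae ?_
    filter_upwards [compl_mem_ae_iff.2 (measure_singleton (0 : EE))] with y hy
    have hy' : lsc m t • y ≠ 0 := smul_ne_zero hl.ne' hy
    have e : ‖y‖ / t ^ ((1 : ℝ) / (2 * m)) = ‖lsc m t • y‖ := by
      rw [← lsc_inv m ht, div_inv_eq_mul, norm_smul, Real.norm_eq_abs, abs_of_pos hl, mul_comm]
    rw [e, fmn_eq hn m hm _ hy']
    ring
  rw [h, integral_const_mul, TT_flip, lsc_pow_n m n ht]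
  linear_combination (t ^ (-(n : ℝ) / (2 * m)) * ∫ y : EE, u₀ (x - y) * HR n m hm (lsc m t • y)) *
    alpha_eq hn m hm hαdef

lemma pde_main (m : ℕ) (hm : 1 ≤ m) {u₀ : EE → ℝ} (hc : Continuous u₀) {M : ℝ} (hM : ∀ x, |u₀ x| ≤ M)
    (x : EE) {t : ℝ} (ht : 0 < t) :
    HasDerivAt (fun s => (lsc m s) ^ n * TT volume u₀ (HR n m hm) (x, lsc m s))
      (-((-1 : ℝ) ^ m * ((lsc m t ^ n * lsc m t ^ (2 * m)) * TT volume u₀ (lapS^[m] (HR n m hm)) (x, lsc m t)))) t := by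
  have hl := lsc_pos m ht
  have hd := lsc_hasDerivAt m hm ht
  have h1 : HasDerivAt (fun s => TT volume u₀ (HR n m hm) (x, lsc m s)) _ t :=
    HasDerivAt.comp t (TT_hasDerivAt hc hM (HR n m hm) x hl) hd
  have h2 := (hd.fun_pow n).mul h1
  refine h2.congr_deriv ?_
  have hid := congrArg (fun G => TT volume u₀ G (x, lsc m t)) (HR_identity (n := n) m hm)
  simp only [TT_add hc hM _ _ x hl, TT_smul] at hid
  have hD : TT volume u₀ (D2 (HR n m hm)) (x, lsc m t) = (2 * m * (-1) ^ m : ℝ) *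
    TT volume u₀ (lapS^[m] (HR n m hm)) (x, lsc m t) - n * TT volume u₀ (HR n m hm) (x, lsc m t) := by
    linarith
  rw [hD]
  generalize TT volume u₀ (lapS^[m] (HR n m hm)) (x, lsc m t) = A
  generalize TT volume u₀ (HR n m hm) (x, lsc m t) = B
  have hm0 : (m : ℝ) ≠ 0 := by positivity
  generalize lsc m t = l at *
  rcases n with _ | n
  · simp
    field_simp
  · simp only [Nat.add_sub_cancel]
    field_simp
    ring

lemma bdd_main (m : ℕ) (hm : 1 ≤ m) {u₀ : EE → ℝ} {M : ℝ} (hM : ∀ x, |u₀ x| ≤ M)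
    (x : EE) {t : ℝ} (ht : 0 < t) :
    |(lsc m t) ^ n * TT volume u₀ (HR n m hm) (x, lsc m t)| ≤ ∫ z, M * ‖HR n m hm z‖ := by
  rw [TT_scale _ _ _ (lsc_pos m ht), ← Real.norm_eq_abs]
  refine norm_integral_le_of_norm_le ((HR n m hm).integrable.norm.const_mul M)
    (Eventually.of_forall fun z => ?_)
  rw [norm_mul]
  gcongr
  exact hM _

lemma lim_main (m : ℕ) (hm : 1 ≤ m) {u₀ : EE → ℝ} (hc : Continuous u₀) {M : ℝ} (hM : ∀ x, |u₀ x| ≤ M)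
    (x : EE) :
    Tendsto (fun q : ℝ × EE => (lsc m q.1) ^ n * TT volume u₀ (HR n m hm) (q.2, lsc m q.1))
      (𝓝[>] 0 ×ˢ 𝓝 x) (𝓝 (u₀ x)) := by
  have hpos : ∀ᶠ q : ℝ × EE in 𝓝[>] 0 ×ˢ 𝓝 x, 0 < q.1 :=
    tendsto_fst.eventually (eventually_mem_nhdsWithin (a := (0:ℝ)) (s := Set.Ioi 0))
  have hlim : Tendsto (fun q : ℝ × EE => ∫ z, u₀ (q.2 - q.1 ^ ((1 : ℝ) / (2 * m)) • z) * HR n m hm z)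
      (𝓝[>] 0 ×ˢ 𝓝 x) (𝓝 (∫ z, u₀ x * HR n m hm z)) := by
    refine tendsto_integral_filter_of_dominated_convergence (fun z => M * ‖HR n m hm z‖)
      (Eventually.of_forall fun q => ?_) (Eventually.of_forall fun q => Eventually.of_forall fun z => ?_)
      ((HR n m hm).integrable.norm.const_mul M) (Eventually.of_forall fun z => ?_)
    · apply Continuous.aestronglyMeasurable
      have := (HR n m hm).continuous
      fun_prop
    · rw [norm_mul]
      gcongr
      exact hM _
    · refine Tendsto.mul_const _ ?_
      have h1 : Tendsto (fun q : ℝ × EE => q.1 ^ ((1 : ℝ) / (2 * m))) (𝓝[>] 0 ×ˢ 𝓝 x) (𝓝 0) := by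
        have hm0 : (0:ℝ) < m := by exact_mod_cast hm
        have h2 : Tendsto (fun s : ℝ => s ^ ((1 : ℝ) / (2 * m))) (𝓝 0) (𝓝 0) := by
          have := (Real.continuous_rpow_const (q := (1 : ℝ) / (2 * m)) (by positivity)).tendsto 0
          rwa [Real.zero_rpow (by positivity)] at this
        exact (h2.mono_left nhdsWithin_le_nhds).comp tendsto_fst
      have h3 : Tendsto (fun q : ℝ × EE => q.2 - q.1 ^ ((1 : ℝ) / (2 * m)) • z) (𝓝[>] 0 ×ˢ 𝓝 x) (𝓝 x) := by
        have := (tendsto_snd (f := 𝓝[>] (0:ℝ)) (g := 𝓝 x)).sub (h1.smul_const z)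
        simpa using this
      exact (hc.tendsto x).comp h3
  rw [integral_const_mul, HR_integral, mul_one] at hlim
  refine hlim.congr' ?_
  filter_upwards [hpos] with q hq
  rw [TT_scale _ _ _ (lsc_pos m hq), lsc_inv m hq]

lemma smooth_main (m : ℕ) (hm : 1 ≤ m) {u₀ : EE → ℝ} (hc : Continuous u₀) {M : ℝ} (hM : ∀ x, |u₀ x| ≤ M) :
    ContDiffOn ℝ (⊤ : ℕ∞) (fun p : EE × ℝ => (lsc m p.2) ^ n * TT volume u₀ (HR n m hm) (p.1, lsc m p.2))
      (Set.univ ×ˢ Set.Ioi (0 : ℝ)) := by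
  have hl : ContDiffOn ℝ (⊤ : ℕ∞) (fun p : EE × ℝ => lsc m p.2) (Set.univ ×ˢ Set.Ioi (0 : ℝ)) := by
    intro p hp
    have hp2 : p.2 ≠ 0 := (ne_of_gt hp.2)
    exact (contDiff_snd.contDiffAt.rpow_const_of_ne hp2).contDiffWithinAt
  refine (hl.pow n).mul ?_
  refine ContDiffOn.comp (t := Set.univ ×ˢ Set.Ioi (0 : ℝ)) (TT_contDiffOn volume hc hM (HR n m hm))
    (contDiff_fst.contDiffOn.prodMk hl) ?_
  intro p hp
  exact ⟨trivial, lsc_pos m hp.2⟩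

end PartE


end Proof

/-- the convolution with the rescaled polyharmonic kernel profile produces a
smooth bounded solution of `∂ₜ u + (-Δ)^m u = 0` which attains the (continuous, bounded)
initial datum locally uniformly as `t → 0⁺`. -/
theorem polyharmonic_heat_solution
    (m n : ℕ) (hm : 1 ≤ m) (hn : 1 ≤ n)
    (u₀ : EuclideanSpace ℝ (Fin n) → ℝ)
    (hu₀cont : Continuous u₀) (hu₀bdd : ∃ M : ℝ, ∀ x, |u₀ x| ≤ M)
    (α : ℝ) (hα : 0 < α)
    (hαdef : α⁻¹ = ∫ x : EuclideanSpace ℝ (Fin n), fmn m n ‖x‖)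
    (u : EuclideanSpace ℝ (Fin n) → ℝ → ℝ)
    (hu : ∀ x t, 0 < t → u x t =
      α * t ^ (-(n : ℝ) / (2 * m)) *
        ∫ y : EuclideanSpace ℝ (Fin n),
          u₀ (x - y) * fmn m n (‖y‖ / t ^ ((1 : ℝ) / (2 * m)))) :
    ContDiffOn ℝ (⊤ : ℕ∞) (fun p : EuclideanSpace ℝ (Fin n) × ℝ => u p.1 p.2)
      (Set.univ ×ˢ Set.Ioi (0 : ℝ)) ∧
    (∃ M : ℝ, ∀ x t, 0 < t → |u x t| ≤ M) ∧
    (∀ x t, 0 < t →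
      deriv (fun s => u x s) t
        + (-1 : ℝ) ^ m * (lap n)^[m] (fun z => u z t) x = 0) ∧
    TendstoLocallyUniformly (fun t x => u x t) u₀ (nhdsWithin 0 (Set.Ioi 0)) := by
  obtain ⟨M, hM⟩ := hu₀bdd
  have hu' : ∀ x t, 0 < t → u x t =
      (lsc m t) ^ n * TT volume u₀ (HR n m hm) (x, lsc m t) := fun x t ht => by
    rw [hu x t ht, u_formula hn m hm hαdef u₀ x ht]
  refine ⟨?_, ⟨∫ z, M * ‖HR n m hm z‖, fun x t ht => ?_⟩, fun x t ht => ?_, ?_⟩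
  · exact (smooth_main m hm hu₀cont hM).congr fun p hp => hu' p.1 p.2 hp.2
  · rw [hu' x t ht]
    exact bdd_main m hm hM x ht
  · have h1 : (fun s => u x s) =ᶠ[𝓝 t]
        (fun s => (lsc m s) ^ n * TT volume u₀ (HR n m hm) (x, lsc m s)) := by
      filter_upwards [lt_mem_nhds ht] with s hs
      exact hu' x s hs
    have h2 : (fun z => u z t) =
        (fun z => (lsc m t) ^ n * TT volume u₀ (HR n m hm) (z, lsc m t)) :=
      funext fun z => hu' z t ht
    rw [h1.deriv_eq, (pde_main m hm hu₀cont hM x ht).deriv, h2,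
      lap_iter_TT hu₀cont hM (lsc_pos m ht)]
    ring
  · rw [tendstoLocallyUniformly_iff_forall_tendsto]
    intro x
    refine Tendsto.mono_right ?_ (nhds_le_uniformity (u₀ x))
    rw [nhds_prod_eq]
    refine Tendsto.prodMk ((hu₀cont.tendsto x).comp tendsto_snd) ?_
    refine (lim_main m hm hu₀cont hM x).congr' ?_
    have hpos : ∀ᶠ q : ℝ × EuclideanSpace ℝ (Fin n) in 𝓝[>] 0 ×ˢ 𝓝 x, 0 < q.1 :=
      tendsto_fst.eventually (eventually_mem_nhdsWithin (a := (0:ℝ)) (s := Set.Ioi 0))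
    filter_upwards [hpos] with q hq
    exact (hu' q.2 q.1 hq).symm
end

section
/- For all integers m ≥ 1 and n ≥ 1 and all η > 0, the derivative of the polyharmonic heat kernel profile satisfies the recurrence f_{m,n}'(η) = −η · f_{m,n+2}(η). -/
open MeasureTheory Real Filter Topology

noncomputable def bT (ν : ℝ) (k : ℕ) (y : ℝ) : ℝ :=
  (-1 : ℝ) ^ k * (y / 2) ^ (2 * k) / (Nat.factorial k * Real.Gamma ((k : ℝ) + ν + 1))

noncomputable def bB (ν y : ℝ) : ℝ := ∑' k : ℕ, bT ν k y

lemma gamma_lower (ν : ℝ) (hν : -1 / 2 ≤ ν) (k : ℕ) :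
    (Nat.factorial (2 * k) : ℝ) * Real.Gamma (ν + 1)
      ≤ 4 ^ k * (Nat.factorial k * Real.Gamma ((k : ℝ) + ν + 1)) := by
  induction k with
  | zero => simp
  | succ k ih =>
    have h0 : (0 : ℝ) ≤ k := Nat.cast_nonneg k
    have h1 : Real.Gamma (((k + 1 : ℕ) : ℝ) + ν + 1) = (k + ν + 1) * Real.Gamma (k + ν + 1) := by
      rw [← Real.Gamma_add_one (by linarith)]
      congr 1
      push_cast
      ring
    have h2 : Nat.factorial (2 * (k + 1)) = (2 * k + 2) * ((2 * k + 1) * Nat.factorial (2 * k)) := by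
      rw [show 2 * (k + 1) = 2 * k + 1 + 1 by ring, Nat.factorial_succ, Nat.factorial_succ]
    rw [h1, h2, Nat.factorial_succ]
    have hG : 0 ≤ Real.Gamma (k + ν + 1) := (Real.Gamma_pos_of_pos (by linarith)).le
    push_cast
    calc _ = (2 * (k : ℝ) + 2) * (2 * k + 1) * ((Nat.factorial (2 * k) : ℝ) * Real.Gamma (ν + 1)) := by
          ring
      _ ≤ (2 * (k : ℝ) + 2) * (2 * k + 1) * (4 ^ k * (Nat.factorial k * Real.Gamma ((k : ℝ) + ν + 1))) := by
          gcongr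
      _ ≤ (2 * (k : ℝ) + 2) * (2 * (k + ν + 1)) *
            (4 ^ k * (Nat.factorial k * Real.Gamma ((k : ℝ) + ν + 1))) := by
          apply mul_le_mul_of_nonneg_right _ (by positivity)
          apply mul_le_mul_of_nonneg_left _ (by positivity)
          linarith
      _ = _ := by ring

lemma bT_bound (ν : ℝ) (hν : -1 / 2 ≤ ν) (k : ℕ) (y R : ℝ) (hy : |y| ≤ R) :
    ‖bT ν k y‖ ≤ R ^ (2 * k) / Nat.factorial (2 * k) * (Real.Gamma (ν + 1))⁻¹ := by
  have h := gamma_lower ν hν k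
  have h0 : (0 : ℝ) ≤ k := Nat.cast_nonneg k
  have hG : 0 < Real.Gamma (k + ν + 1) := Real.Gamma_pos_of_pos (by linarith)
  have hG' : 0 < Real.Gamma (ν + 1) := Real.Gamma_pos_of_pos (by linarith)
  have e : ‖bT ν k y‖ = |y| ^ (2 * k) / (4 ^ k * (Nat.factorial k * Real.Gamma (k + ν + 1))) := by
    unfold bT
    rw [norm_div, norm_mul, norm_pow, norm_pow, norm_mul]
    simp only [norm_neg, norm_one, one_pow, one_mul, Real.norm_eq_abs, abs_div, div_pow]
    rw [abs_of_pos hG, pow_mul |(2 : ℝ)|, Nat.abs_cast]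
    norm_num
    rw [div_div]
  have hR : 0 ≤ R := (abs_nonneg y).trans hy
  rw [e, ← div_eq_mul_inv, div_div]
  gcongr

lemma bound_hasSum (ν R : ℝ) :
    HasSum (fun k : ℕ => R ^ (2 * k) / Nat.factorial (2 * k) * (Real.Gamma (ν + 1))⁻¹)
      (Real.cosh R * (Real.Gamma (ν + 1))⁻¹) :=
  (Real.hasSum_cosh R).mul_right _

lemma bT_summable (ν : ℝ) (hν : -1 / 2 ≤ ν) (y : ℝ) : Summable (fun k => bT ν k y) :=
  Summable.of_norm_bounded (bound_hasSum ν |y|).summable (fun k => bT_bound ν hν k y |y| le_rfl)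

lemma bB_bound (ν : ℝ) (hν : -1 / 2 ≤ ν) (y R : ℝ) (hy : |y| ≤ R) :
    |bB ν y| ≤ Real.cosh R * (Real.Gamma (ν + 1))⁻¹ :=
  tsum_of_norm_bounded (bound_hasSum ν R) (fun k => bT_bound ν hν k y R hy)

lemma bT_deriv_succ (ν : ℝ) (hν : -1 / 2 ≤ ν) (k : ℕ) (y : ℝ) :
    HasDerivAt (bT ν (k + 1)) (-(y / 2) * bT (ν + 1) k y) y := by
  have h0 : (0 : ℝ) ≤ k := Nat.cast_nonneg k
  have hG : Real.Gamma (k + (ν + 1) + 1) ≠ 0 := (Real.Gamma_pos_of_pos (by linarith)).ne'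
  have h := ((((hasDerivAt_id y).div_const 2).pow (2 * (k + 1))).const_mul ((-1 : ℝ) ^ (k + 1))).div_const
    (Nat.factorial (k + 1) * Real.Gamma (((k + 1 : ℕ) : ℝ) + ν + 1))
  refine HasDerivAt.congr_deriv h ?_
  unfold bT
  rw [show ((k + 1 : ℕ) : ℝ) + ν + 1 = k + (ν + 1) + 1 by push_cast; ring, Nat.factorial_succ,
    show 2 * (k + 1) - 1 = 2 * k + 1 by omega]
  have hf : (Nat.factorial k : ℝ) ≠ 0 := by positivity
  have hk : (k : ℝ) + 1 ≠ 0 := by positivity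
  push_cast
  simp only [id]
  field_simp
  ring

lemma bB_deriv (ν : ℝ) (hν : -1 / 2 ≤ ν) (y : ℝ) :
    HasDerivAt (bB ν) (-(y / 2) * bB (ν + 1) y) y := by
  have hν' : -1 / 2 ≤ ν + 1 := by linarith
  set R := |y| + 1 with hR
  have key : HasDerivAt (fun z => ∑' k : ℕ, bT ν (k + 1) z)
      (∑' k : ℕ, -(y / 2) * bT (ν + 1) k y) y := by
    refine hasDerivAt_tsum_of_isPreconnected (u := fun k : ℕ => R / 2 *
        (R ^ (2 * k) / Nat.factorial (2 * k) * (Real.Gamma (ν + 1 + 1))⁻¹))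
      (t := Metric.ball 0 R) (y₀ := y) (g' := fun k z => -(z / 2) * bT (ν + 1) k z)
      ((bound_hasSum (ν + 1) R).summable.mul_left _) Metric.isOpen_ball
      (convex_ball _ _).isPreconnected (fun k z _ => bT_deriv_succ ν hν k z) ?_ ?_ ?_ ?_
    · intro k z hz
      have hz' : |z| ≤ R := by simpa using (mem_ball_zero_iff.1 hz).le
      rw [norm_mul]
      apply mul_le_mul _ (bT_bound (ν + 1) hν' k z R hz') (norm_nonneg _) (by positivity)
      rw [norm_neg, Real.norm_eq_abs, abs_div, abs_two]
      gcongr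
    · simp [hR]
    · exact (summable_nat_add_iff 1).2 (bT_summable ν hν y)
    · simp [hR]
  rw [tsum_mul_left] at key
  have e : bB ν = fun z => bT ν 0 0 + ∑' k : ℕ, bT ν (k + 1) z := by
    funext z
    unfold bB
    rw [(bT_summable ν hν z).tsum_eq_zero_add]
    simp [bT]
  rw [e]
  exact key.const_add _

lemma bB_cont (ν : ℝ) (hν : -1 / 2 ≤ ν) : Continuous (bB ν) :=
  continuous_iff_continuousAt.2 fun y => (bB_deriv ν hν y).continuousAt

lemma besselJ_eq (ν y : ℝ) (hy : 0 < y) : besselJ ν y = (y / 2) ^ ν * bB ν y := by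
  unfold besselJ bB
  rw [← tsum_mul_left]
  congr 1
  funext k
  unfold bT
  rw [Real.rpow_add (by positivity), show (2 * k : ℝ) = ((2 * k : ℕ) : ℝ) by push_cast; ring,
    Real.rpow_natCast]
  ring

noncomputable def gI (m p : ℕ) (ν η : ℝ) : ℝ :=
  ∫ s in Set.Ioi (0 : ℝ), Real.exp (-(s ^ (2 * m))) * s ^ p * bB ν (η * s)

lemma fmn_eq_s2 (m p : ℕ) (η : ℝ) (hη : 0 < η) :
    fmn m (p + 1) η = 2 ^ (-(((p : ℝ) - 1) / 2)) * gI m p (((p : ℝ) - 1) / 2) η := by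
  unfold fmn gI
  rw [← integral_const_mul, ← integral_const_mul]
  refine setIntegral_congr_fun measurableSet_Ioi ?_
  intro s hs
  have hs : 0 < s := hs
  have hy : 0 < η * s := by positivity
  simp only
  rw [show (((p + 1 : ℕ) : ℝ) - 2) / 2 = ((p : ℝ) - 1) / 2 by push_cast; ring,
    besselJ_eq _ _ hy, Real.div_rpow hy.le (by norm_num), Real.rpow_neg (by norm_num)]
  have e1 : (η * s) ^ (((p + 1 : ℕ) : ℝ) / 2) * (η * s) ^ (((p : ℝ) - 1) / 2) = η ^ p * s ^ p := by
    rw [← Real.rpow_add hy, ← mul_pow, ← Real.rpow_natCast]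
    congr 1
    push_cast
    ring
  have e2 : η ^ ((1 : ℝ) - ((p + 1 : ℕ) : ℝ)) * η ^ p = 1 := by
    rw [← Real.rpow_natCast, ← Real.rpow_add hη]
    push_cast
    simp
  calc _ = η ^ ((1 : ℝ) - ((p + 1 : ℕ) : ℝ)) * ((η * s) ^ (((p + 1 : ℕ) : ℝ) / 2) *
          (η * s) ^ (((p : ℝ) - 1) / 2)) * (Real.exp (-(s ^ (2 * m))) *
          (2 ^ (((p : ℝ) - 1) / 2))⁻¹ * bB (((p : ℝ) - 1) / 2) (η * s)) := by ring
    _ = (η ^ ((1 : ℝ) - ((p + 1 : ℕ) : ℝ)) * η ^ p) * s ^ p * (Real.exp (-(s ^ (2 * m))) *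
          (2 ^ (((p : ℝ) - 1) / 2))⁻¹ * bB (((p : ℝ) - 1) / 2) (η * s)) := by rw [e1]; ring
    _ = _ := by rw [e2]; ring

lemma bound_integrable (m q : ℕ) (hm : 1 ≤ m) (c : ℝ) :
    IntegrableOn (fun s : ℝ => Real.exp (-(s ^ (2 * m))) * s ^ q * Real.cosh (c * s))
      (Set.Ioi 0) := by
  have h1 : IntegrableOn (fun s : ℝ => Real.exp (1 + c ^ 2 / 2) *
      (s ^ (q : ℝ) * Real.exp (-(1 / 2) * s ^ (2 : ℝ)))) (Set.Ioi 0) :=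
    (integrableOn_rpow_mul_exp_neg_mul_rpow (by have : (0 : ℝ) ≤ q := Nat.cast_nonneg q; linarith)
      (by norm_num) (by norm_num)).const_mul _
  refine Integrable.mono' h1 (Continuous.aestronglyMeasurable (by fun_prop)) ?_
  refine (ae_restrict_iff' measurableSet_Ioi).2 (Eventually.of_forall fun s hs => ?_)
  have hs : 0 < s := hs
  have hc : Real.cosh (c * s) ≤ Real.exp (|c| * s) := by
    rw [← Real.cosh_abs, abs_mul, abs_of_pos hs, Real.cosh_eq]
    have : Real.exp (-(|c| * s)) ≤ Real.exp (|c| * s) := by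
      apply Real.exp_le_exp.2
      have : 0 ≤ |c| * s := by positivity
      linarith
    linarith
  have hp : s ^ 2 ≤ 1 + s ^ (2 * m) := by
    rcases le_total s 1 with h | h
    · have : s ^ 2 ≤ 1 := pow_le_one₀ hs.le h
      have : 0 ≤ s ^ (2 * m) := by positivity
      linarith
    · have : s ^ 2 ≤ s ^ (2 * m) := pow_le_pow_right₀ h (by omega)
      linarith
  rw [Real.norm_of_nonneg (by have := Real.cosh_pos (c * s); positivity), Real.rpow_natCast,
    show (2 : ℝ) = ((2 : ℕ) : ℝ) by norm_num, Real.rpow_natCast]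
  calc _ ≤ Real.exp (-(s ^ (2 * m))) * s ^ q * Real.exp (|c| * s) := by gcongr
    _ = s ^ q * Real.exp (-(s ^ (2 * m)) + |c| * s) := by rw [Real.exp_add]; ring
    _ ≤ s ^ q * Real.exp ((1 + c ^ 2 / 2) + (-(1 / 2) * s ^ 2)) := by
        refine mul_le_mul_of_nonneg_left (Real.exp_le_exp.2 ?_) (by positivity)
        nlinarith [sq_nonneg (|c| - s), sq_abs c]
    _ = _ := by rw [Real.exp_add]; push_cast; ring

lemma gI_deriv (m p : ℕ) (hm : 1 ≤ m) (ν : ℝ) (hν : -1 / 2 ≤ ν) (η : ℝ) (hη : 0 < η) :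
    HasDerivAt (gI m p ν) (-(η / 2) * gI m (p + 2) (ν + 1) η) η := by
  have hν' : -1 / 2 ≤ ν + 1 := by linarith
  have hc := bB_cont ν hν
  have hc' := bB_cont (ν + 1) hν'
  have h := hasDerivAt_integral_of_dominated_loc_of_deriv_le
    (μ := volume.restrict (Set.Ioi (0 : ℝ)))
    (F := fun x s => Real.exp (-(s ^ (2 * m))) * s ^ p * bB ν (x * s))
    (F' := fun x s => Real.exp (-(s ^ (2 * m))) * s ^ p * (-(x * s / 2) * bB (ν + 1) (x * s) * s))
    (bound := fun s => ((η + 1) / 2 * (Real.Gamma (ν + 1 + 1))⁻¹) *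
      (Real.exp (-(s ^ (2 * m))) * s ^ (p + 2) * Real.cosh ((η + 1) * s)))
    (x₀ := η) (s := Metric.ball η 1) (Metric.ball_mem_nhds _ one_pos)
    (Eventually.of_forall fun x => Continuous.aestronglyMeasurable (by fun_prop))
    ?_ (Continuous.aestronglyMeasurable (by fun_prop)) ?_
    ((bound_integrable m (p + 2) hm (η + 1)).const_mul _) ?_
  · have h2 := h.2
    refine h2.congr_deriv ?_
    unfold gI
    rw [← integral_const_mul]
    congr 1
    funext s
    ring
  · refine Integrable.mono' ((bound_integrable m p hm η).const_mul (Real.Gamma (ν + 1))⁻¹)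
      (Continuous.aestronglyMeasurable (by fun_prop)) ?_
    refine (ae_restrict_iff' measurableSet_Ioi).2 (Eventually.of_forall fun s hs => ?_)
    have hs : 0 < s := hs
    have hb := bB_bound ν hν (η * s) (η * s) (by rw [abs_of_pos (by positivity)])
    rw [norm_mul, Real.norm_of_nonneg (by positivity), Real.norm_eq_abs]
    calc _ ≤ Real.exp (-(s ^ (2 * m))) * s ^ p * (Real.cosh (η * s) * (Real.Gamma (ν + 1))⁻¹) := by
          gcongr
      _ = _ := by ring
  · refine (ae_restrict_iff' measurableSet_Ioi).2 (Eventually.of_forall fun s hs x hx => ?_)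
    have hs : 0 < s := hs
    have hx : |x| ≤ η + 1 := by
      rw [Metric.mem_ball, Real.dist_eq, abs_lt] at hx
      rw [abs_le]
      constructor <;> linarith
    have hb := bB_bound (ν + 1) hν' (x * s) ((η + 1) * s) (by
      rw [abs_mul, abs_of_pos hs]
      gcongr)
    rw [norm_mul, Real.norm_of_nonneg (by positivity), Real.norm_eq_abs, abs_mul, abs_mul, abs_neg,
      abs_div, abs_mul, abs_of_pos hs, abs_two]
    calc _ ≤ Real.exp (-(s ^ (2 * m))) * s ^ p * ((η + 1) * s / 2 *
          (Real.cosh ((η + 1) * s) * (Real.Gamma (ν + 1 + 1))⁻¹) * s) := by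
          gcongr
      _ = _ := by ring
  · refine Eventually.of_forall fun s x _ => ?_
    have h1 : HasDerivAt (fun x : ℝ => x * s) s x := by
      simpa using (hasDerivAt_id x).mul_const s
    exact ((bB_deriv ν hν (x * s)).comp x h1).const_mul _

/-- the recurrence `f_{m,n}'(η) = -η f_{m,n+2}(η)`. -/
theorem fmn_deriv_recurrence (m n : ℕ) (hm : 1 ≤ m) (hn : 1 ≤ n) (η : ℝ) (hη : 0 < η) :
    deriv (fmn m n) η = -η * fmn m (n + 2) η := by
  obtain ⟨p, rfl⟩ : ∃ p, n = p + 1 := ⟨n - 1, by omega⟩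
  have hp : (0 : ℝ) ≤ p := Nat.cast_nonneg p
  have hev : fmn m (p + 1) =ᶠ[𝓝 η]
      fun x => 2 ^ (-(((p : ℝ) - 1) / 2)) * gI m p (((p : ℝ) - 1) / 2) x := by
    filter_upwards [lt_mem_nhds hη] with x hx using fmn_eq_s2 m p x hx
  rw [hev.deriv_eq, ((gI_deriv m p hm _ (by linarith) η hη).const_mul _).deriv,
    show p + 1 + 2 = (p + 2) + 1 by ring, fmn_eq_s2 m (p + 2) η hη,
    show (((p + 2 : ℕ) : ℝ) - 1) / 2 = ((p : ℝ) - 1) / 2 + 1 by push_cast; ring, neg_add,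
    Real.rpow_add two_pos, Real.rpow_neg_one]
  ring
end

section
/- Let n ≥ 1 and set σ = 3·2^{1/3}/16 and K_n = (2π)^{−n/2}/(√3 · 2^{(n−3)/3}). Then as η → ∞, f_n(η) = (K_n/(α_n η^{n/3})) · { cos(√3 σ η^{4/3} − nπ/6) + O(η^{−4/3}) } · e^{−σ η^{4/3}}; that is, there exist C > 0 and η_0 > 0 such that | f_n(η) η^{n/3} e^{σ η^{4/3}} − (K_n/α_n) cos(√3 σ η^{4/3} − nπ/6) | ≤ C η^{−4/3} for all η ≥ η_0. -/
open MeasureTheory Real Filter Topology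

lemma bk_mul_cpow {r : ℝ} (hr : 0 < r) (a c : ℂ) :
    ((r : ℂ) * a) ^ c = (r : ℂ) ^ c * a ^ c := by
  by_cases ha : a = 0
  · by_cases hc : c = 0
    · simp [hc]
    · simp [ha, hc]
  have hr' : (r : ℂ) ≠ 0 := by exact_mod_cast hr.ne'
  rw [Complex.cpow_def_of_ne_zero (mul_ne_zero hr' ha), Complex.cpow_def_of_ne_zero hr',
    Complex.cpow_def_of_ne_zero ha, Complex.log_ofReal_mul hr ha, ← Complex.exp_add,
    Complex.ofReal_log hr.le]
  congr 1
  ring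

lemma bk_gauss_line (δ w : ℝ) :
    ∫ u : ℝ, Complex.exp (((δ : ℂ) + u * Complex.I) ^ 2 / 4 - ((δ : ℂ) + u * Complex.I) * w)
      = ((2 * √π * Real.exp (-w ^ 2) : ℝ) : ℂ) := by
  have h := integral_cexp_quadratic (b := (-1 / 4 : ℂ)) (by norm_num)
    (Complex.I * (δ / 2 - w)) (δ ^ 2 / 4 - δ * w)
  have e : ∀ u : ℝ, ((δ : ℂ) + u * Complex.I) ^ 2 / 4 - ((δ : ℂ) + u * Complex.I) * w
      = (-1 / 4 : ℂ) * u ^ 2 + (Complex.I * (δ / 2 - w)) * u + (δ ^ 2 / 4 - δ * w) := by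
    intro u
    linear_combination ((u : ℂ) ^ 2 / 4) * Complex.I_sq
  simp_rw [e, h]
  have e1 : (π / -(-1 / 4 : ℂ)) ^ (1 / 2 : ℂ) = ((2 * √π : ℝ) : ℂ) := by
    have : (π / -(-1 / 4 : ℂ)) = ((4 * π : ℝ) : ℂ) := by push_cast; ring
    rw [this, show (1 / 2 : ℂ) = ((1 / 2 : ℝ) : ℂ) by push_cast; ring,
      ← Complex.ofReal_cpow (by positivity), ← Real.sqrt_eq_rpow, Real.sqrt_mul (by norm_num)]
    congr 2
    rw [show (4 : ℝ) = 2 ^ 2 by norm_num, Real.sqrt_sq (by norm_num)]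
  rw [e1, Complex.ofReal_mul (2 * √π), Complex.ofReal_exp]
  congr 2
  push_cast
  linear_combination (δ / 2 - w : ℂ) ^ 2 * Complex.I_sq

lemma bk_moment_int (a : ℂ) (ha : 0 < a.re) (N : ℕ) :
    IntegrableOn (fun s : ℝ => (s : ℂ) ^ N * Complex.exp (-a * s ^ 2)) (Set.Ioi 0) := by
  have h := integrableOn_rpow_mul_exp_neg_mul_sq ha (s := N) (by have := N.cast_nonneg (α := ℝ); linarith)
  refine h.mono' (by fun_prop) ?_
  refine (ae_restrict_iff' measurableSet_Ioi).2 (Eventually.of_forall fun s hs => ?_)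
  have hs' : (0 : ℝ) < s := hs
  rw [norm_mul, norm_pow, Complex.norm_exp, Complex.norm_real, Real.norm_of_nonneg hs'.le,
    Real.rpow_natCast]
  apply le_of_eq
  congr 2
  rw [← Complex.ofReal_pow, Complex.re_mul_ofReal]
  simp

lemma bk_moment (a : ℂ) (ha : 0 < a.re) (N : ℕ) :
    ∫ s in Set.Ioi (0 : ℝ), (s : ℂ) ^ N * Complex.exp (-a * s ^ 2)
      = ((Real.Gamma (((N : ℝ) + 1) / 2) : ℝ) : ℂ) / 2 * a ^ (-(((N : ℝ) + 1) / 2 : ℝ) : ℂ) := by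
  have ha0 : a ≠ 0 := by rintro rfl; simp at ha
  induction N using Nat.twoStepInduction with
  | zero =>
    have h := integral_gaussian_complex_Ioi ha
    simp only [pow_zero, one_mul]
    rw [h]
    have hg : ((Nat.cast 0 : ℝ) + 1) / 2 = 1 / 2 := by norm_num
    rw [hg, Real.Gamma_one_half_eq]
    have : (π / a : ℂ) = (π : ℝ) * a⁻¹ := by rw [div_eq_mul_inv]
    rw [this, bk_mul_cpow pi_pos, show (1 / 2 : ℂ) = ((1 / 2 : ℝ) : ℂ) by push_cast; ring,
      ← Complex.ofReal_cpow pi_pos.le, ← Real.sqrt_eq_rpow, Complex.inv_cpow, ← Complex.cpow_neg]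
    · ring
    · intro h; rw [Complex.arg_eq_pi_iff] at h; linarith [h.1]
  | one =>
    have h := integral_mul_cexp_neg_mul_sq ha
    simp only [pow_one]
    rw [h]
    have hg : ((Nat.cast 1 : ℝ) + 1) / 2 = 1 := by norm_num
    rw [hg, Real.Gamma_one]
    push_cast
    rw [Complex.cpow_neg, Complex.cpow_one, mul_inv]
    ring
  | more N ih _ =>
    have hd : ∀ s ∈ Set.Ioi (0 : ℝ), HasDerivAt (fun s : ℝ => (s : ℂ) ^ (N + 1) * Complex.exp (-a * s ^ 2))
        ((N + 1 : ℂ) * ((s : ℂ) ^ N * Complex.exp (-a * s ^ 2)) - 2 * a * ((s : ℂ) ^ (N + 2) * Complex.exp (-a * s ^ 2))) s := by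
      intro s _
      have h1 : HasDerivAt (fun z : ℂ => z ^ (N + 1) * Complex.exp (-a * z ^ 2))
        ((N + 1 : ℂ) * ((s : ℂ) ^ N * Complex.exp (-a * s ^ 2)) - 2 * a * ((s : ℂ) ^ (N + 2) * Complex.exp (-a * s ^ 2))) (s : ℂ) := by
        have := (hasDerivAt_pow (N + 1) (s : ℂ)).mul (((hasDerivAt_pow 2 (s : ℂ)).const_mul (-a)).cexp)
        refine this.congr_deriv ?_
        rw [Nat.add_sub_cancel]
        push_cast
        ring
      exact h1.comp_ofReal
    have i0 := bk_moment_int a ha N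
    have i2 := bk_moment_int a ha (N + 2)
    have hi : IntegrableOn (fun s : ℝ => (N + 1 : ℂ) * ((s : ℂ) ^ N * Complex.exp (-a * s ^ 2)) - 2 * a * ((s : ℂ) ^ (N + 2) * Complex.exp (-a * s ^ 2))) (Set.Ioi 0) :=
      (i0.const_mul _).sub (i2.const_mul _)
    have ht : Tendsto (fun s : ℝ => (s : ℂ) ^ (N + 1) * Complex.exp (-a * s ^ 2)) atTop (𝓝 0) := by
      exact tendsto_zero_of_hasDerivAt_of_integrableOn_Ioi hd hi (bk_moment_int a ha (N + 1))
    have h := integral_Ioi_of_hasDerivAt_of_tendsto (a := 0) (by fun_prop) hd hi ht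
    rw [integral_sub (i0.const_mul _) (i2.const_mul _), integral_const_mul, integral_const_mul, ih] at h
    have hz : 2 * a * ∫ s in Set.Ioi (0 : ℝ), (s : ℂ) ^ (N + 2) * Complex.exp (-a * s ^ 2) = (N + 1 : ℂ) * (((Real.Gamma (((N : ℝ) + 1) / 2) : ℝ) : ℂ) / 2 * a ^ (-(((N : ℝ) + 1) / 2 : ℝ) : ℂ)) := by
      have : (((0 : ℝ) : ℂ) ^ (N + 1) * Complex.exp (-a * ((0 : ℝ) : ℂ) ^ 2)) = 0 := by simp
      rw [this] at h
      linear_combination -h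
    have hg : Real.Gamma ((((N + 2 : ℕ) : ℝ) + 1) / 2) = (((N : ℝ) + 1) / 2) * Real.Gamma (((N : ℝ) + 1) / 2) := by
      rw [← Real.Gamma_add_one (by positivity)]
      congr 1
      push_cast; ring
    have hp : a ^ (-((((N : ℝ) + 1) / 2 : ℝ) : ℂ)) = a ^ (-((((N + 2 : ℕ) : ℝ) + 1) / 2 : ℝ) : ℂ) * a := by
      nth_rewrite 3 [← Complex.cpow_one a]
      rw [← Complex.cpow_add _ _ ha0]
      congr 1
      push_cast; ring
    apply mul_left_cancel₀ (mul_ne_zero two_ne_zero ha0)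
    rw [hz, hg, hp]
    push_cast
    ring

noncomputable def bkG (n : ℕ) (η s : ℝ) : ℝ :=
  (η * s) ^ ((n : ℝ) / 2) * besselJ (((n : ℝ) - 2) / 2) (η * s)

lemma bk_moment_real (δ : ℝ) (hδ : 0 < δ) (N : ℕ) :
    ∫ s in Set.Ioi (0 : ℝ), s ^ N * Real.exp (-δ * s ^ 2)
      = Real.Gamma (((N : ℝ) + 1) / 2) / 2 * δ ^ (-(((N : ℝ) + 1) / 2)) := by
  have h := bk_moment (δ : ℂ) (by simpa using hδ) N
  have h2 : ∫ s in Set.Ioi (0 : ℝ), (s : ℂ) ^ N * Complex.exp (-(δ : ℂ) * s ^ 2)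
      = ((∫ s in Set.Ioi (0 : ℝ), s ^ N * Real.exp (-δ * s ^ 2) : ℝ) : ℂ) := by
    rw [← integral_complex_ofReal]
    congr 1
    ext s
    push_cast
    rfl
  rw [h2, ← Complex.ofReal_neg, ← Complex.ofReal_cpow hδ.le] at h
  exact_mod_cast h

lemma bk_T (n : ℕ) (hn : 1 ≤ n) (η s : ℝ) (hη : 0 < η) (hs : 0 < s) (k : ℕ) :
    (η * s) ^ ((n : ℝ) / 2) * ((-1 : ℝ) ^ k * (η * s / 2) ^ ((2 * k : ℝ) + ((n : ℝ) - 2) / 2) /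
    (Nat.factorial k * Real.Gamma ((k : ℝ) + ((n : ℝ) - 2) / 2 + 1)))
    = ((-1 : ℝ) ^ k * 2 ^ ((n : ℝ) / 2) * (η / 2) ^ (2 * k + (n - 1)) /
      (Nat.factorial k * Real.Gamma ((((2 * k + (n - 1) : ℕ) : ℝ) + 1) / 2))) * s ^ (2 * k + (n - 1)) := by
  obtain ⟨m, rfl⟩ : ∃ m, n = m + 1 := ⟨n - 1, by omega⟩
  simp only [Nat.add_sub_cancel]
  have e1 : (k : ℝ) + (((m + 1 : ℕ) : ℝ) - 2) / 2 + 1 = (((2 * k + m : ℕ) : ℝ) + 1) / 2 := by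
    push_cast; ring
  have hp : 0 < η * s / 2 := by positivity
  have e2 : (η * s) ^ (((m + 1 : ℕ) : ℝ) / 2) = 2 ^ (((m + 1 : ℕ) : ℝ) / 2) * (η * s / 2) ^ (((m + 1 : ℕ) : ℝ) / 2) := by
    rw [← Real.mul_rpow (by norm_num) hp.le]
    congr 1
    ring
  have e3 : (η * s / 2) ^ (((m + 1 : ℕ) : ℝ) / 2) * (η * s / 2) ^ ((2 * k : ℝ) + (((m + 1 : ℕ) : ℝ) - 2) / 2)
      = (η / 2) ^ (2 * k + m) * s ^ (2 * k + m) := by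
    rw [← Real.rpow_add hp, ← mul_pow, ← Real.rpow_natCast]
    congr 1
    · ring
    · push_cast; ring
  rw [e1, e2]
  linear_combination (2 ^ (((m + 1 : ℕ) : ℝ) / 2) * (-1 : ℝ) ^ k / (Nat.factorial k * Real.Gamma ((((2 * k + m : ℕ) : ℝ) + 1) / 2))) * e3

lemma bk_bessel (n : ℕ) (hn : 1 ≤ n) (η : ℝ) (hη : 0 < η) (a : ℂ) (ha : 0 < a.re) :
    ∫ s in Set.Ioi (0 : ℝ), Complex.exp (-a * s ^ 2) * (bkG n η s : ℂ)
      = (η : ℂ) ^ (n - 1) * ((2 * a) ^ (-(n / 2 : ℝ) : ℂ) * Complex.exp (-η ^ 2 / (4 * a))) := by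
  have ha0 : a ≠ 0 := by rintro rfl; simp at ha
  let c : ℕ → ℝ := fun k => ((-1 : ℝ) ^ k * 2 ^ ((n : ℝ) / 2) * (η / 2) ^ (2 * k + (n - 1)) /
      (Nat.factorial k * Real.Gamma ((((2 * k + (n - 1) : ℕ) : ℝ) + 1) / 2)))
  let F : ℕ → ℝ → ℂ := fun k s => (c k : ℂ) * ((s : ℂ) ^ (2 * k + (n - 1)) * Complex.exp (-a * s ^ 2))
  have hN : ∀ k : ℕ, (((2 * k + (n - 1) : ℕ) : ℝ) + 1) / 2 = k + n / 2 := by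
    intro k
    obtain ⟨m, rfl⟩ : ∃ m, n = m + 1 := ⟨n - 1, by omega⟩
    push_cast [Nat.add_sub_cancel]; ring
  have hn0 : (0 : ℝ) < n := by exact_mod_cast hn
  have hΓ : ∀ k : ℕ, 0 < Real.Gamma (k + n / 2 : ℝ) := fun k => Real.Gamma_pos_of_pos (by positivity)
  have hFi : ∀ k, Integrable (F k) (volume.restrict (Set.Ioi 0)) := fun k =>
    (bk_moment_int a ha _).const_mul _
  have hFn : ∀ k, ∫ s in Set.Ioi (0 : ℝ), ‖F k s‖ = (2 ^ ((n : ℝ) / 2) * (η / 2) ^ (n - 1) / 2 * a.re ^ (-(n / 2 : ℝ))) *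
      ((η ^ 2 / (4 * a.re)) ^ k / (Nat.factorial k)) := by
    intro k
    have : ∀ s ∈ Set.Ioi (0 : ℝ), ‖F k s‖ = |c k| * (s ^ (2 * k + (n - 1)) * Real.exp (-a.re * s ^ 2)) := by
      intro s hs
      have hs' : (0 : ℝ) < s := hs
      simp only [F]
      rw [norm_mul, norm_mul, norm_pow, Complex.norm_exp, Complex.norm_real, Complex.norm_real,
        Real.norm_of_nonneg hs'.le, Real.norm_eq_abs]
      congr 3
      rw [← Complex.ofReal_pow, Complex.re_mul_ofReal]
      simp
    rw [setIntegral_congr_fun measurableSet_Ioi this, integral_const_mul, bk_moment_real _ ha]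
    simp only [c]
    rw [hN, abs_div, abs_mul, abs_mul, abs_pow, abs_neg, abs_one, one_pow, one_mul,
      abs_of_pos (show (0 : ℝ) < 2 ^ ((n : ℝ) / 2) by positivity), abs_of_pos (show (0 : ℝ) < (η / 2) ^ (2 * k + (n - 1)) by positivity),
      abs_of_pos (mul_pos (Nat.cast_pos.2 (Nat.factorial_pos k)) (hΓ k)), neg_add,
      Real.rpow_add ha, Real.rpow_neg ha.le, Real.rpow_natCast, pow_add, pow_mul]
    have := (hΓ k).ne'
    have h4 : (η ^ 2 / (4 * a.re)) ^ k = ((η / 2) ^ 2) ^ k * (a.re ^ k)⁻¹ := by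
      rw [← inv_pow, ← mul_pow]; congr 1; field_simp; ring
    rw [h4]
    field_simp
  have hFs : Summable fun k => ∫ s in Set.Ioi (0 : ℝ), ‖F k s‖ := by
    simp_rw [hFn]
    exact (Real.summable_pow_div_factorial _).mul_left _
  have hs := hasSum_integral_of_summable_integral_norm hFi hFs
  have hFv : ∀ k, ∫ s in Set.Ioi (0 : ℝ), F k s = ((2 : ℂ) ^ ((n / 2 : ℝ) : ℂ) * (η / 2) ^ (n - 1) / 2 * a ^ (-(n / 2 : ℝ) : ℂ)) *
      ((-η ^ 2 / (4 * a)) ^ k / (Nat.factorial k)) := by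
    intro k
    simp only [F]
    rw [integral_const_mul, bk_moment a ha]
    simp only [c]
    rw [hN]
    have e1 : a ^ (-((k + n / 2 : ℝ) : ℂ)) = (a ^ k)⁻¹ * a ^ (-(n / 2 : ℝ) : ℂ) := by
      rw [Complex.ofReal_add, neg_add, Complex.cpow_add _ _ ha0, Complex.cpow_neg, Complex.ofReal_natCast, Complex.cpow_natCast]
    have e2 : (-η ^ 2 / (4 * a)) ^ k = (-1) ^ k * ((η / 2 : ℂ) ^ 2) ^ k * (a ^ k)⁻¹ := by
      rw [← inv_pow, ← mul_pow, ← mul_pow]; congr 1; field_simp; ring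
    have e3 : (((2 : ℝ) ^ ((n : ℝ) / 2) : ℝ) : ℂ) = (2 : ℂ) ^ ((n / 2 : ℝ) : ℂ) := by
      rw [Complex.ofReal_cpow (by norm_num)]; norm_num
    have h5 : ((Real.Gamma (k + n / 2 : ℝ) : ℝ) : ℂ) ≠ 0 := by exact_mod_cast (hΓ k).ne'
    have h6 : ((Nat.factorial k : ℕ) : ℂ) ≠ 0 := by exact_mod_cast (Nat.factorial_pos k).ne'
    rw [e1, e2, ← e3]
    simp only [Complex.ofReal_div, Complex.ofReal_mul, Complex.ofReal_pow, Complex.ofReal_neg, Complex.ofReal_one, Complex.ofReal_natCast, Complex.ofReal_ofNat]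
    rw [pow_add, pow_mul]
    generalize ((Real.Gamma (k + n / 2 : ℝ) : ℝ) : ℂ) = g at h5 ⊢
    field_simp
  have hv : ∀ s ∈ Set.Ioi (0 : ℝ), ∑' k, F k s = Complex.exp (-a * s ^ 2) * (bkG n η s : ℂ) := by
    intro s hs
    simp only [F, bkG, besselJ]
    rw [← tsum_mul_left, Complex.ofReal_tsum, ← tsum_mul_left]
    congr 1
    ext k
    rw [bk_T n hn η s hη hs k]
    simp only [c]
    push_cast
    ring
  rw [← setIntegral_congr_fun measurableSet_Ioi hv]
  rw [← hs.tsum_eq]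
  simp_rw [hFv]
  rw [tsum_mul_left]
  have he : ∑' k : ℕ, (-η ^ 2 / (4 * a)) ^ k / (Nat.factorial k : ℂ) = Complex.exp (-η ^ 2 / (4 * a)) := by
    rw [Complex.exp_eq_exp_ℂ, NormedSpace.exp_eq_tsum_div]
  rw [he, show (2 * a) = ((2 : ℝ) : ℂ) * a by push_cast; rfl, bk_mul_cpow (by norm_num)]
  have e7 : (2 : ℂ) ^ ((n / 2 : ℝ) : ℂ) = ((2 : ℝ) : ℂ) ^ (-(n / 2 : ℝ) : ℂ) * (2 * 2 ^ (n - 1)) := by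
    rw [← pow_succ', show n - 1 + 1 = n by omega, ← Complex.cpow_natCast]
    push_cast
    rw [← Complex.cpow_add _ _ two_ne_zero]
    congr 1
    ring
  rw [e7, div_pow]
  field_simp

lemma bk_re (δ u : ℝ) : ((δ : ℂ) + u * Complex.I).re = δ := by simp

lemma bk_G_int (n : ℕ) (hn : 1 ≤ n) (η : ℝ) (hη : 0 < η) (a : ℂ) (ha : 0 < a.re) :
    IntegrableOn (fun s : ℝ => Complex.exp (-a * s ^ 2) * (bkG n η s : ℂ)) (Set.Ioi 0) := by
  apply Integrable.of_integral_ne_zero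
  have ha0 : a ≠ 0 := by rintro rfl; simp at ha
  rw [bk_bessel n hn η hη a ha]
  have : (η : ℂ) ≠ 0 := by exact_mod_cast hη.ne'
  refine mul_ne_zero (pow_ne_zero _ this) (mul_ne_zero ?_ (Complex.exp_ne_zero _))
  rw [Complex.cpow_def_of_ne_zero (mul_ne_zero two_ne_zero ha0)]
  exact Complex.exp_ne_zero _

lemma bk_gauss_line_int (δ : ℝ) :
    Integrable fun u : ℝ => Complex.exp (((δ : ℂ) + u * Complex.I) ^ 2 / 4) := by
  apply Integrable.of_integral_ne_zero
  have h := bk_gauss_line δ 0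
  simp only [Complex.ofReal_zero, mul_zero, sub_zero] at h
  rw [h]
  have : (0 : ℝ) < 2 * √π * Real.exp (-0 ^ 2) := by positivity
  exact_mod_cast this.ne'

lemma bk_rep (n : ℕ) (hn : 1 ≤ n) (η : ℝ) (hη : 0 < η) (δ : ℝ) (hδ : 0 < δ) :
    ∫ u : ℝ, Complex.exp (((δ : ℂ) + u * Complex.I) ^ 2 / 4) *
      ((2 * ((δ : ℂ) + u * Complex.I)) ^ (-(n / 2 : ℝ) : ℂ) *
        Complex.exp (-η ^ 2 / (4 * ((δ : ℂ) + u * Complex.I))))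
    = ((2 * √π * fmn 2 n η : ℝ) : ℂ) := by
  have hη0 : (η : ℂ) ≠ 0 := by exact_mod_cast hη.ne'
  have hI : Integrable (fun p : ℝ × ℝ => Complex.exp (((δ : ℂ) + p.1 * Complex.I) ^ 2 / 4) *
      (Complex.exp (-(δ : ℂ) * p.2 ^ 2) * (bkG n η p.2 : ℂ))) (volume.prod (volume.restrict (Set.Ioi (0 : ℝ)))) :=
    (bk_gauss_line_int δ).mul_prod (bk_G_int n hn η hη δ (by simpa using hδ))
  have hI2 : Integrable (Function.uncurry fun (u s : ℝ) => Complex.exp (((δ : ℂ) + u * Complex.I) ^ 2 / 4) *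
      (Complex.exp (-((δ : ℂ) + u * Complex.I) * s ^ 2) * (bkG n η s : ℂ))) (volume.prod (volume.restrict (Set.Ioi (0 : ℝ)))) := by
    have := hI.bdd_mul (c := 1) (f := fun p : ℝ × ℝ => Complex.exp ((-(p.1 * p.2 ^ 2) : ℝ) * Complex.I))
      (by apply Continuous.aestronglyMeasurable; fun_prop) (Eventually.of_forall fun p => by
        rw [Complex.norm_exp_ofReal_mul_I])
    refine this.congr (Eventually.of_forall fun p => ?_)
    simp only [Function.uncurry]
    have e : Complex.exp (-((δ : ℂ) + p.1 * Complex.I) * p.2 ^ 2) = Complex.exp ((-(p.1 * p.2 ^ 2) : ℝ) * Complex.I) * Complex.exp (-(δ : ℂ) * p.2 ^ 2) := by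
      rw [← Complex.exp_add]; congr 1; push_cast; ring
    rw [e]; ring
  have hsw := integral_integral_swap hI2
  have hL : ∀ u : ℝ, ∫ s in Set.Ioi (0 : ℝ), Complex.exp (((δ : ℂ) + u * Complex.I) ^ 2 / 4) *
      (Complex.exp (-((δ : ℂ) + u * Complex.I) * s ^ 2) * (bkG n η s : ℂ))
      = (η : ℂ) ^ (n - 1) * (Complex.exp (((δ : ℂ) + u * Complex.I) ^ 2 / 4) *
      ((2 * ((δ : ℂ) + u * Complex.I)) ^ (-(n / 2 : ℝ) : ℂ) *
        Complex.exp (-η ^ 2 / (4 * ((δ : ℂ) + u * Complex.I))))) := by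
    intro u
    rw [integral_const_mul, bk_bessel n hn η hη _ (by simpa using hδ)]
    ring
  have hR : ∀ s : ℝ, ∫ u : ℝ, Complex.exp (((δ : ℂ) + u * Complex.I) ^ 2 / 4) *
      (Complex.exp (-((δ : ℂ) + u * Complex.I) * s ^ 2) * (bkG n η s : ℂ))
      = ((2 * √π * (Real.exp (-(s ^ (2 * 2))) * (η * s) ^ ((n : ℝ) / 2) *
        besselJ (((n : ℝ) - 2) / 2) (η * s)) : ℝ) : ℂ) := by
    intro s
    have h := bk_gauss_line δ (s ^ 2)
    have e : ∀ u : ℝ, Complex.exp (((δ : ℂ) + u * Complex.I) ^ 2 / 4) *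
      (Complex.exp (-((δ : ℂ) + u * Complex.I) * s ^ 2) * (bkG n η s : ℂ)) =
      Complex.exp (((δ : ℂ) + u * Complex.I) ^ 2 / 4 - ((δ : ℂ) + u * Complex.I) * ((s ^ 2 : ℝ) : ℂ)) * (bkG n η s : ℂ) := by
      intro u
      rw [← mul_assoc, ← Complex.exp_add]
      congr 2
      push_cast; ring
    simp_rw [e]
    rw [integral_mul_const, h, ← Complex.ofReal_mul, bkG]
    congr 1
    rw [← pow_mul]
    ring
  simp_rw [hL, hR] at hsw
  rw [integral_const_mul] at hsw
  apply mul_left_cancel₀ (pow_ne_zero (n - 1) hη0)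
  rw [hsw]
  rw [integral_complex_ofReal, integral_const_mul, fmn]
  generalize (∫ s in Set.Ioi (0 : ℝ), Real.exp (-(s ^ (2 * 2))) * (η * s) ^ ((n : ℝ) / 2) *
        besselJ (((n : ℝ) - 2) / 2) (η * s)) = Q
  have e : η ^ ((1 : ℝ) - n) = (η ^ (n - 1))⁻¹ := by
    rw [← Real.rpow_natCast, ← Real.rpow_neg hη.le, Nat.cast_sub hn]
    congr 1
    push_cast; ring
  rw [e]
  push_cast
  field_simp

lemma bk_alpha (n : ℕ) (hn : 1 ≤ n) :
    ∫ x : EuclideanSpace ℝ (Fin n), fmn 2 n ‖x‖ = (2 * π) ^ ((n : ℝ) / 2) := by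
  let V := EuclideanSpace ℝ (Fin n)
  have : Nonempty (Fin n) := ⟨⟨0, hn⟩⟩
  let A : ℝ → ℂ := fun u => (1 : ℂ) + u * Complex.I
  have hA : ∀ u, (A u).re = 1 := fun u => by simp [A]
  have hA0 : ∀ u, A u ≠ 0 := fun u h => by have := hA u; rw [h] at this; simp at this
  have hAc : Continuous A := by fun_prop
  have hinv : ∀ u, 0 < (1 / (4 * A u)).re := by
    intro u
    rw [one_div, Complex.inv_re]
    have : 0 < Complex.normSq (4 * A u) := Complex.normSq_pos.2 (mul_ne_zero (by norm_num) (hA0 u))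
    have h4 : (4 * A u).re = 4 := by simp [A]
    rw [h4]
    positivity
  let P : ℝ → ℂ := fun u => Complex.exp (A u ^ 2 / 4) * (2 * A u) ^ (-(n / 2 : ℝ) : ℂ)
  let Φ : ℝ → V → ℂ := fun u x => P u * Complex.exp (-(1 / (4 * A u)) * ‖x‖ ^ 2)
  have hPc : Continuous P := by
    apply Continuous.mul (by fun_prop)
    apply Continuous.cpow (by fun_prop) (by fun_prop)
    intro u
    left
    simp [A]
  have hΦc : Continuous (Function.uncurry Φ) := by
    apply Continuous.mul (by fun_prop)
    apply Complex.continuous_exp.comp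
    apply Continuous.mul
    · apply Continuous.neg
      apply Continuous.div (by fun_prop) (by fun_prop)
      intro p
      exact mul_ne_zero (by norm_num) (hA0 _)
    · fun_prop
  have hrep : ∀ x : V, x ≠ 0 → ∫ u, Φ u x = ((2 * √π * fmn 2 n ‖x‖ : ℝ) : ℂ) := by
    intro x hx
    rw [← bk_rep n hn ‖x‖ (norm_pos_iff.2 hx) 1 one_pos]
    congr 1
    ext u
    simp only [Φ, P, A, Complex.ofReal_one]
    rw [mul_assoc]
    congr 3
    ring
  have hx : ∀ u, ∫ x : V, Φ u x = ((2 * π) ^ ((n : ℝ) / 2) : ℝ) * Complex.exp (A u ^ 2 / 4) := by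
    intro u
    simp only [Φ]
    rw [integral_const_mul, GaussianFourier.integral_cexp_neg_mul_sq_norm (hinv u)]
    simp only [P, V, finrank_euclideanSpace, Fintype.card_fin]
    have e1 : (π / (1 / (4 * A u)) : ℂ) = ((2 * π : ℝ) : ℂ) * (2 * A u) := by
      push_cast; field_simp; ring
    rw [e1, bk_mul_cpow (by positivity), Complex.ofReal_cpow (by positivity)]
    have e2 : (2 * A u) ^ (-(n / 2 : ℝ) : ℂ) * (2 * A u) ^ ((n : ℂ) / 2) = 1 := by
      rw [← Complex.cpow_add _ _ (mul_ne_zero two_ne_zero (hA0 u))]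
      push_cast
      rw [neg_add_cancel, Complex.cpow_zero]
    push_cast at e2 ⊢
    linear_combination (Complex.exp (A u ^ 2 / 4) * (2 * (π : ℂ)) ^ ((n : ℂ) / 2)) * e2
  have hΦi : Integrable (Function.uncurry Φ) (volume.prod volume) := by
    rw [integrable_prod_iff hΦc.aestronglyMeasurable]
    constructor
    · refine Eventually.of_forall fun u => ?_
      simp only [Function.uncurry]
      have h := GaussianFourier.integrable_cexp_neg_mul_sq_norm_add (V := V) (hinv u) 0 0
      simp only [zero_mul, add_zero, Complex.ofReal_zero] at h
      exact h.const_mul _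
    · have e : ∀ u, ∫ x : V, ‖Function.uncurry Φ (u, x)‖ = Real.exp ((1 - u ^ 2) / 4) * (2 * π) ^ ((n : ℝ) / 2) * (Real.sqrt (1 + u ^ 2)) ^ ((n : ℝ) / 2) := by
        intro u
        have hn2 : Complex.normSq (A u) = 1 + u ^ 2 := by simp [A, Complex.normSq_apply]; ring
        have hnn : ‖A u‖ = Real.sqrt (1 + u ^ 2) := by rw [Complex.norm_def, hn2]
        have hb : (1 / (4 * A u)).re = 1 / (4 * (1 + u ^ 2)) := by
          rw [one_div, Complex.inv_re, Complex.normSq_mul, hn2]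
          simp [A]
          field_simp
        have hq : ∀ x : V, ‖Function.uncurry Φ (u, x)‖ = ‖P u‖ * Real.exp (-(1 / (4 * A u)).re * ‖x‖ ^ 2) := by
          intro x
          simp only [Function.uncurry, Φ]
          rw [norm_mul, Complex.norm_exp, ← Complex.ofReal_pow, Complex.re_mul_ofReal, Complex.neg_re]
        simp_rw [hq]
        rw [integral_const_mul, GaussianFourier.integral_rexp_neg_mul_sq_norm (hinv u), hb]
        simp only [P, V, finrank_euclideanSpace, Fintype.card_fin]
        rw [norm_mul, Complex.norm_exp, ← Complex.ofReal_neg, Complex.norm_cpow_real, norm_mul, hnn]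
        have e1 : (A u ^ 2 / 4).re = (1 - u ^ 2) / 4 := by
          have : A u ^ 2 / 4 = ((1 - u ^ 2) / 4 : ℝ) + (u / 2 : ℝ) * Complex.I := by
            simp only [A]; push_cast; linear_combination (u ^ 2 / 4 : ℂ) * Complex.I_sq
          rw [this, Complex.add_re, Complex.ofReal_re, Complex.re_ofReal_mul]; simp
        have hs : 0 < Real.sqrt (1 + u ^ 2) := Real.sqrt_pos.2 (by positivity)
        have e2 : π / (1 / (4 * (1 + u ^ 2))) = (2 * π) * Real.sqrt (1 + u ^ 2) * (2 * Real.sqrt (1 + u ^ 2)) := by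
          have := Real.mul_self_sqrt (show 0 ≤ 1 + u ^ 2 by positivity)
          field_simp
          nlinarith
        rw [e1, e2, Real.mul_rpow (x := 2 * π * Real.sqrt (1 + u ^ 2)) (by positivity) (by positivity), Real.mul_rpow (x := 2 * π) (by positivity) (by positivity)]
        have e3 : (2 * Real.sqrt (1 + u ^ 2)) ^ (-((n : ℝ) / 2)) * (2 * Real.sqrt (1 + u ^ 2)) ^ ((n : ℝ) / 2) = 1 := by
          rw [← Real.rpow_add (by positivity), neg_add_cancel, Real.rpow_zero]
        have e4 : ‖(2 : ℂ)‖ = 2 := by simp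
        rw [e4]
        linear_combination (Real.exp ((1 - u ^ 2) / 4) * (2 * π) ^ ((n : ℝ) / 2) * (Real.sqrt (1 + u ^ 2)) ^ ((n : ℝ) / 2)) * e3
      simp_rw [e]
      have hc : Continuous fun u : ℝ => Real.exp ((1 - u ^ 2) / 4) * (2 * π) ^ ((n : ℝ) / 2) * (Real.sqrt (1 + u ^ 2)) ^ ((n : ℝ) / 2) := by
        apply Continuous.mul (by fun_prop)
        apply Continuous.rpow_const (by fun_prop)
        intro u; right; positivity
      have hdom : Integrable fun u : ℝ => (Real.exp (1 / 4) * (2 * π) ^ ((n : ℝ) / 2) * (8 ^ n * n.factorial * Real.exp (1 / 8))) * Real.exp (-(1 / 8) * u ^ 2) :=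
        (integrable_exp_neg_mul_sq (by norm_num)).const_mul _
      refine hdom.mono' hc.aestronglyMeasurable (Eventually.of_forall fun u => ?_)
      have hw : 1 ≤ 1 + u ^ 2 := by nlinarith [sq_nonneg u]
      have h1 : (Real.sqrt (1 + u ^ 2)) ^ ((n : ℝ) / 2) ≤ (1 + u ^ 2) ^ n := by
        rw [← Real.rpow_natCast (1 + u ^ 2) n]
        refine (Real.rpow_le_rpow (Real.sqrt_nonneg _) (y := 1 + u ^ 2) ?_ (by positivity)).trans
          (Real.rpow_le_rpow_of_exponent_le hw ?_)
        · rw [Real.sqrt_le_left (by positivity)]; nlinarith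
        · have : (0 : ℝ) ≤ n := n.cast_nonneg
          linarith
      have h2 := Real.pow_div_factorial_le_exp ((1 + u ^ 2) / 8) (by positivity) n
      have h3 : (1 + u ^ 2) ^ n ≤ 8 ^ n * n.factorial * Real.exp ((1 + u ^ 2) / 8) := by
        rw [div_le_iff₀ (by positivity), div_pow, div_le_iff₀ (by positivity)] at h2
        linarith
      rw [Real.norm_of_nonneg (by positivity)]
      calc Real.exp ((1 - u ^ 2) / 4) * (2 * π) ^ ((n : ℝ) / 2) * (Real.sqrt (1 + u ^ 2)) ^ ((n : ℝ) / 2)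
          ≤ Real.exp ((1 - u ^ 2) / 4) * (2 * π) ^ ((n : ℝ) / 2) * (8 ^ n * n.factorial * Real.exp ((1 + u ^ 2) / 8)) := by
            gcongr; exact h1.trans h3
        _ = _ := by
            have e5 : Real.exp ((1 - u ^ 2) / 4) * Real.exp ((1 + u ^ 2) / 8) = Real.exp (1 / 4) * Real.exp (1 / 8) * Real.exp (-(1 / 8) * u ^ 2) := by
              rw [← Real.exp_add, ← Real.exp_add, ← Real.exp_add]; congr 1; ring
            linear_combination ((2 * π) ^ ((n : ℝ) / 2) * 8 ^ n * n.factorial) * e5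
  have hsw := integral_integral_swap hΦi
  simp_rw [hx] at hsw
  have h0 : ∀ᵐ x : V, x ≠ 0 := by
    rw [ae_iff]; simp
  rw [integral_const_mul, integral_congr_ae (h0.mono fun x hx => hrep x hx), integral_complex_ofReal, integral_const_mul] at hsw
  have hg := bk_gauss_line 1 0
  simp only [Complex.ofReal_zero, mul_zero, sub_zero, Complex.ofReal_one] at hg
  simp only [A] at hsw
  rw [hg, ← Complex.ofReal_mul, Complex.ofReal_inj] at hsw
  have hp : 0 < 2 * √π := by positivity
  apply mul_left_cancel₀ hp.ne'
  rw [← hsw]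
  simp
  ring

lemma bk_second_order (f f' : ℂ → ℂ) (S : Set ℂ) (hS : Convex ℝ S) (L : ℝ) (hL : 0 ≤ L) (w z : ℂ)
    (hw : w ∈ S) (hz : z ∈ S) (hd : ∀ ζ ∈ S, HasDerivAt f (f' ζ) ζ)
    (hl : ∀ ζ ∈ S, ‖f' ζ - f' w‖ ≤ L * ‖ζ - w‖) :
    ‖f z - f w - f' w * (z - w)‖ ≤ L * ‖z - w‖ ^ 2 := by
  have hseg : segment ℝ w z ⊆ S := hS.segment_subset hw hz
  have h := Convex.norm_image_sub_le_of_norm_hasDerivWithin_le (𝕜 := ℂ)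
    (f := fun ζ => f ζ - f' w * ζ) (f' := fun ζ => f' ζ - f' w)
    (s := segment ℝ w z) (C := L * ‖z - w‖) (x := w) (y := z)
    (fun ζ hζ => by
      have h1 := (hd ζ (hseg hζ)).sub ((hasDerivAt_id ζ).const_mul (f' w))
      rw [mul_one] at h1
      exact h1.hasDerivWithinAt)
    (fun ζ hζ => (hl ζ (hseg hζ)).trans (by
      gcongr
      exact norm_sub_le_of_mem_segment hζ))
    (convex_segment _ _) (left_mem_segment _ _ _) (right_mem_segment _ _ _)
  calc _ = ‖f z - f' w * z - (f w - f' w * w)‖ := by congr 1; ring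
    _ ≤ _ := h
    _ = _ := by ring

lemma bk_cpow_norm_le (c x : ℝ) (hc : c ≤ 0) (hx : 0 < x) (z : ℂ) (hz : x ≤ z.re) :
    ‖z ^ (c : ℂ)‖ ≤ x ^ c := by
  rw [Complex.norm_cpow_real]
  exact Real.rpow_le_rpow_of_nonpos hx (hz.trans (Complex.re_le_norm z)) hc

lemma bk_cpow_deriv (c x : ℝ) (hx : 0 < x) (z : ℂ) (hz : x ≤ z.re) :
    HasDerivAt (fun z : ℂ => z ^ (c : ℂ)) (c * z ^ ((c - 1 : ℝ) : ℂ)) z := by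
  have h := (hasDerivAt_id z).cpow_const (c := (c : ℂ)) (Or.inl (show 0 < z.re by linarith))
  simpa using h

lemma bk_cpow_lip (c x : ℝ) (hc : c ≤ 0) (hx : 0 < x) (z w : ℂ) (hz : x ≤ z.re) (hw : x ≤ w.re) :
    ‖z ^ (c : ℂ) - w ^ (c : ℂ)‖ ≤ |c| * x ^ (c - 1) * ‖z - w‖ := by
  refine Convex.norm_image_sub_le_of_norm_hasDerivWithin_le (𝕜 := ℂ)
    (s := {z : ℂ | x ≤ z.re}) (f := fun z : ℂ => z ^ (c : ℂ)) (f' := fun z => c * z ^ ((c - 1 : ℝ) : ℂ))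
    (fun ζ hζ => (bk_cpow_deriv c x hx ζ hζ).hasDerivWithinAt) (fun ζ hζ => ?_) (convex_halfSpace_re_ge x) hw hz
  rw [norm_mul, Complex.norm_real, Real.norm_eq_abs]
  gcongr
  exact bk_cpow_norm_le _ _ (by linarith) hx _ hζ

lemma bk_cpow_second (c x : ℝ) (hc : c ≤ 0) (hx : 0 < x) (z w : ℂ) (hz : x ≤ z.re) (hw : x ≤ w.re) :
    ‖z ^ (c : ℂ) - w ^ (c : ℂ) - (c * w ^ ((c - 1 : ℝ) : ℂ)) * (z - w)‖
      ≤ (|c| * (|c - 1| * x ^ (c - 1 - 1))) * ‖z - w‖ ^ 2 := by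
  refine bk_second_order (fun z => z ^ (c : ℂ)) (fun z => c * z ^ ((c - 1 : ℝ) : ℂ)) {z : ℂ | x ≤ z.re}
    (convex_halfSpace_re_ge x) _ (by positivity) w z hw hz (fun ζ hζ => bk_cpow_deriv c x hx ζ hζ) (fun ζ hζ => ?_)
  rw [← mul_sub, norm_mul, Complex.norm_real, Real.norm_eq_abs, mul_assoc]
  gcongr
  exact bk_cpow_lip (c - 1) x (by linarith) hx ζ w hζ hw

lemma bk_exp_second (M : ℝ) (A B : ℂ) (hA : A.re ≤ M) (hB : B.re ≤ M) :
    ‖Complex.exp A - Complex.exp B - Complex.exp B * (A - B)‖ ≤ Real.exp M * ‖A - B‖ ^ 2 := by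
  refine bk_second_order Complex.exp Complex.exp {z : ℂ | z.re ≤ M}
    (convex_halfSpace_re_le M) _ (by positivity) B A hB hA (fun ζ hζ => Complex.hasDerivAt_exp ζ) (fun ζ hζ => ?_)
  refine Convex.norm_image_sub_le_of_norm_hasDerivWithin_le (𝕜 := ℂ)
    (s := {z : ℂ | z.re ≤ M}) (f := Complex.exp) (f' := Complex.exp)
    (fun ζ hζ => (Complex.hasDerivAt_exp ζ).hasDerivWithinAt) (fun ζ hζ => ?_) (convex_halfSpace_re_le M) hB hζ
  rw [Complex.norm_exp]
  exact Real.exp_le_exp.2 hζ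

noncomputable def bkW (μ y : ℝ) : ℝ := (y ^ 2 + μ * y ^ 4 + μ ^ 2 * y ^ 6) * Real.exp (-μ * y ^ 2)

lemma bk_pow_gauss_int (b : ℝ) (hb : 0 < b) (k : ℕ) :
    Integrable fun y : ℝ => y ^ k * Real.exp (-b * y ^ 2) := by
  have h := integrable_rpow_mul_exp_neg_mul_sq hb (s := k) (by have := k.cast_nonneg (α := ℝ); linarith)
  simpa using h

lemma bkW_int (μ : ℝ) (hμ : 0 < μ) : Integrable (bkW μ) := by
  have := ((bk_pow_gauss_int μ hμ 2).add ((bk_pow_gauss_int μ hμ 4).const_mul μ)).add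
    ((bk_pow_gauss_int μ hμ 6).const_mul (μ ^ 2))
  refine this.congr (Eventually.of_forall fun y => ?_)
  simp only [bkW, Pi.add_apply]
  ring

lemma bkW_scale (μ : ℝ) (hμ : 0 < μ) : ∫ y, bkW μ y = (∫ y, bkW 1 y) * (μ⁻¹ * (√μ)⁻¹) := by
  have e : ∀ y, bkW μ y = μ⁻¹ * bkW 1 (√μ * y) := by
    intro y
    have h := Real.sq_sqrt hμ.le
    have h4 : (√μ) ^ 4 = μ ^ 2 := by rw [← h]; ring_nf; rw [h]
    have h6 : (√μ) ^ 6 = μ ^ 3 := by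
      calc (√μ) ^ 6 = ((√μ) ^ 2) ^ 3 := by ring
        _ = _ := by rw [h]
    simp only [bkW, mul_pow, h, h4, h6]
    rw [show -1 * (μ * y ^ 2) = -μ * y ^ 2 by ring]
    field_simp
  simp_rw [e]
  rw [integral_const_mul, Measure.integral_comp_mul_left (fun y => bkW 1 y), abs_of_pos (by positivity), smul_eq_mul]
  ring

lemma bk_odd_int (f : ℝ → ℝ) (hf : ∀ y, f (-y) = - f y) : ∫ y, f y = 0 := by
  have h := integral_neg_eq_self f volume
  simp_rw [hf, integral_neg] at h
  linarith

noncomputable def bkZ (x v : ℝ) : ℂ := (x : ℂ) + v * Complex.I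

lemma bkZ_re (x v : ℝ) : (bkZ x v).re = x := by simp [bkZ]

lemma bkZ_ne (x v : ℝ) (hx : 0 < x) : bkZ x v ≠ 0 := by
  intro h; have := bkZ_re x v; rw [h] at this; simp at this; linarith

lemma bkZ_norm (x v : ℝ) : x ≤ ‖bkZ x v‖ := by
  have := Complex.re_le_norm (bkZ x v); rwa [bkZ_re] at this

lemma bkZ_cont (x : ℝ) : Continuous (bkZ x) := by unfold bkZ; fun_prop

lemma bkZ_cube (x v₀ : ℝ) (hx3 : 16 * x ^ 3 = 1) (hv : v₀ ^ 2 = 3 * x ^ 2) :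
    2 * bkZ x v₀ ^ 3 = -1 := by
  have h1 : (16 * x ^ 3 : ℂ) = 1 := by exact_mod_cast hx3
  have h2 : (v₀ ^ 2 : ℂ) = 3 * x ^ 2 := by exact_mod_cast hv
  unfold bkZ
  have : ((x : ℂ) + v₀ * Complex.I) ^ 3 = x ^ 3 - 3 * x * v₀ ^ 2 + (3 * x ^ 2 - v₀ ^ 2) * v₀ * Complex.I := by
    linear_combination (3 * x * v₀ ^ 2 + v₀ ^ 3 * Complex.I : ℂ) * Complex.I_sq
  rw [this, h2]
  linear_combination -h1

lemma bk_phase (x v₀ v : ℝ) (hx : 0 < x) (hx3 : 16 * x ^ 3 = 1) (hv : v₀ ^ 2 = 3 * x ^ 2) :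
    (bkZ x v ^ 2 - 1 / bkZ x v) - (bkZ x v₀ ^ 2 - 1 / bkZ x v₀)
      = -((v - v₀ : ℝ) : ℂ) ^ 2 * (1 + 2 * bkZ x v₀ / bkZ x v) := by
  have h0 := bkZ_ne x v₀ hx
  have h1 := bkZ_ne x v hx
  have hc := bkZ_cube x v₀ hx3 hv
  have hd : bkZ x v - bkZ x v₀ = ((v - v₀ : ℝ) : ℂ) * Complex.I := by
    unfold bkZ; push_cast; ring
  have hd2 : -((v - v₀ : ℝ) : ℂ) ^ 2 = (bkZ x v - bkZ x v₀) ^ 2 := by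
    rw [hd, mul_pow, Complex.I_sq]; ring
  rw [hd2]
  generalize bkZ x v = z at *
  generalize bkZ x v₀ = w at *
  field_simp
  linear_combination (z - w) * hc

lemma bk_phase_re (x v₀ v : ℝ) (hx : 0 < x) (hv0 : 0 < v₀) (hvv : 0 < v) :
    1 ≤ (1 + 2 * bkZ x v₀ / bkZ x v).re := by
  have : (2 * bkZ x v₀ / bkZ x v).re = 2 * (x * x + v₀ * v) / (x * x + v * v) := by
    rw [Complex.div_re]
    simp [bkZ, Complex.normSq_apply]
    ring
  rw [Complex.add_re, this, Complex.one_re]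
  have : 0 ≤ 2 * (x * x + v₀ * v) / (x * x + v * v) := by positivity
  linarith

set_option maxHeartbeats 1600000 in
/-- pointwise Laplace bound to the right of zero -/
lemma bk_point (x v₀ c : ℝ) (hc : c ≤ 0) (hx : 0 < x) (hv0 : 0 < v₀) (hx3 : 16 * x ^ 3 = 1)
    (hv : v₀ ^ 2 = 3 * x ^ 2) : ∃ C : ℝ, ∀ μ : ℝ, 0 < μ → ∀ v : ℝ, 0 < v →
    ‖bkZ x v ^ (c : ℂ) * Complex.exp (μ * ((bkZ x v ^ 2 - 1 / bkZ x v) - (bkZ x v₀ ^ 2 - 1 / bkZ x v₀)))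
      - (bkZ x v₀ ^ (c : ℂ) + (c * bkZ x v₀ ^ ((c - 1 : ℝ) : ℂ) * Complex.I) * (v - v₀ : ℝ)
          + bkZ x v₀ ^ (c : ℂ) * (2 * Complex.I / bkZ x v₀) * (μ * (v - v₀) ^ 3 : ℝ))
        * (Real.exp (-(3 * μ) * (v - v₀) ^ 2) : ℝ)‖ ≤ C * bkW μ (v - v₀) := by
  set H := x ^ c
  set L1 := |c| * x ^ (c - 1)
  set L2 := |c| * (|c - 1| * x ^ (c - 1 - 1))
  have hH : 0 ≤ H := by positivity
  have hL1 : 0 ≤ L1 := by positivity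
  have hL2 : 0 ≤ L2 := by positivity
  refine ⟨H * (4 / x ^ 2) + L2 + H * (2 / x ^ 2) + L1 * (2 / x), fun μ hμ v hvv => ?_⟩
  have h0 := bkZ_ne x v₀ hx
  have h1 := bkZ_ne x v hx
  rw [bk_phase x v₀ v hx hx3 hv]
  have hq := bk_phase_re x v₀ v hx hv0 hvv
  have hd : bkZ x v - bkZ x v₀ = ((v - v₀ : ℝ) : ℂ) * Complex.I := by
    unfold bkZ; push_cast; ring
  have hz := bkZ_norm x v
  have hw := bkZ_norm x v₀
  have b1 := bk_cpow_norm_le c x hc hx (bkZ x v) (bkZ_re x v).ge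
  have b2 := bk_cpow_lip c x hc hx (bkZ x v) (bkZ x v₀) (bkZ_re x v).ge (bkZ_re x v₀).ge
  have b3 := bk_cpow_second c x hc hx (bkZ x v) (bkZ x v₀) (bkZ_re x v).ge (bkZ_re x v₀).ge
  generalize bkZ x v = z at *
  generalize bkZ x v₀ = w at *
  generalize v - v₀ = y at *
  have hnd : ‖z - w‖ = |y| := by rw [hd]; simp
  rw [hnd] at b2 b3
  set A : ℂ := μ * (-(y : ℂ) ^ 2 * (1 + 2 * w / z)) with hA
  set B : ℂ := ((-(3 * μ) * y ^ 2 : ℝ) : ℂ) with hB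
  have hAB : A - B = 2 * Complex.I / z * (μ * y ^ 3 : ℝ) := by
    have : (y : ℂ) * Complex.I = z - w := hd.symm
    rw [hA, hB]
    push_cast
    field_simp
    linear_combination (-2 * μ * y ^ 2 : ℂ) * this
  have hBre : B.re ≤ -μ * y ^ 2 := by
    rw [hB, Complex.ofReal_re]; nlinarith [mul_nonneg hμ.le (sq_nonneg y)]
  have hAre : A.re ≤ -μ * y ^ 2 := by
    have : A = ((-μ * y ^ 2 : ℝ) : ℂ) * (1 + 2 * w / z) := by rw [hA]; push_cast; ring
    rw [this, Complex.re_ofReal_mul]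
    nlinarith [mul_nonneg hμ.le (sq_nonneg y)]
  have b4 := bk_exp_second _ A B hAre hBre
  set E := Real.exp (-μ * y ^ 2) with hE
  have hE0 : 0 < E := Real.exp_pos _
  have hBn : ‖Complex.exp B‖ ≤ E := by rw [Complex.norm_exp]; exact Real.exp_le_exp.2 hBre
  have hBe : ((Real.exp (-(3 * μ) * y ^ 2) : ℝ) : ℂ) = Complex.exp B := by rw [hB, Complex.ofReal_exp]
  rw [hBe]
  have hDn : ‖A - B‖ ≤ 2 / x * (μ * |y| ^ 3) := by
    rw [hAB, norm_mul, norm_div, Complex.norm_real, norm_mul, Complex.norm_I, Real.norm_eq_abs, abs_mul, abs_pow, abs_of_pos hμ]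
    simp only [Complex.norm_ofNat, mul_one]
    gcongr
  have hD0n : ‖2 * Complex.I / w * (μ * y ^ 3 : ℝ)‖ ≤ 2 / x * (μ * |y| ^ 3) := by
    rw [norm_mul, norm_div, Complex.norm_real, norm_mul, Complex.norm_I, Real.norm_eq_abs, abs_mul, abs_pow, abs_of_pos hμ]
    simp only [Complex.norm_ofNat, mul_one]
    gcongr
  have hDD : ‖(A - B) - 2 * Complex.I / w * (μ * y ^ 3 : ℝ)‖ ≤ 2 / x ^ 2 * (μ * y ^ 4) := by
    have : (A - B) - 2 * Complex.I / w * (μ * y ^ 3 : ℝ) = 2 * Complex.I * (w - z) / (z * w) * (μ * y ^ 3 : ℝ) := by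
      rw [hAB]; field_simp
    rw [this, norm_mul, norm_div, Complex.norm_real, norm_mul, norm_mul, norm_mul, Complex.norm_I, norm_sub_rev, hnd, Real.norm_eq_abs, abs_mul, abs_pow, abs_of_pos hμ]
    simp only [Complex.norm_ofNat, mul_one]
    have : y ^ 4 = |y| * |y| ^ 3 := by
      rw [← pow_succ', show (3 + 1) = 2 * 2 by norm_num, pow_mul, sq_abs]; ring
    rw [this]
    calc 2 * |y| / (‖z‖ * ‖w‖) * (μ * |y| ^ 3) ≤ 2 * |y| / (x * x) * (μ * |y| ^ 3) := by gcongr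
      _ = _ := by field_simp
  have key : z ^ (c : ℂ) * Complex.exp A - (w ^ (c : ℂ) + c * w ^ ((c - 1 : ℝ) : ℂ) * Complex.I * (y : ℝ)
          + w ^ (c : ℂ) * (2 * Complex.I / w) * (μ * y ^ 3 : ℝ)) * Complex.exp B
      = z ^ (c : ℂ) * (Complex.exp A - Complex.exp B - Complex.exp B * (A - B))
        + (z ^ (c : ℂ) - w ^ (c : ℂ) - (c * w ^ ((c - 1 : ℝ) : ℂ)) * (z - w)) * Complex.exp B
        + z ^ (c : ℂ) * ((A - B) - 2 * Complex.I / w * (μ * y ^ 3 : ℝ)) * Complex.exp B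
        + (z ^ (c : ℂ) - w ^ (c : ℂ)) * (2 * Complex.I / w * (μ * y ^ 3 : ℝ)) * Complex.exp B := by
    rw [hd]; ring
  have n1 : ‖z ^ (c : ℂ) * (Complex.exp A - Complex.exp B - Complex.exp B * (A - B))‖ ≤ H * (4 / x ^ 2) * (μ ^ 2 * y ^ 6 * E) := by
    rw [norm_mul]
    calc _ ≤ H * (E * (2 / x * (μ * |y| ^ 3)) ^ 2) := by
          gcongr
          exact b4.trans (by gcongr)
      _ = H * (4 / x ^ 2) * (μ ^ 2 * (|y| ^ 2) ^ 3 * E) := by ring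
      _ = _ := by rw [sq_abs]; ring
  have n2 : ‖(z ^ (c : ℂ) - w ^ (c : ℂ) - (c * w ^ ((c - 1 : ℝ) : ℂ)) * (z - w)) * Complex.exp B‖ ≤ L2 * (y ^ 2 * E) := by
    rw [norm_mul]
    calc _ ≤ (L2 * |y| ^ 2) * E := by gcongr
      _ = _ := by rw [sq_abs]; ring
  have n3 : ‖z ^ (c : ℂ) * ((A - B) - 2 * Complex.I / w * (μ * y ^ 3 : ℝ)) * Complex.exp B‖ ≤ H * (2 / x ^ 2) * (μ * y ^ 4 * E) := by
    rw [norm_mul, norm_mul]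
    calc _ ≤ H * (2 / x ^ 2 * (μ * y ^ 4)) * E := by gcongr
      _ = _ := by ring
  have n4 : ‖(z ^ (c : ℂ) - w ^ (c : ℂ)) * (2 * Complex.I / w * (μ * y ^ 3 : ℝ)) * Complex.exp B‖ ≤ L1 * (2 / x) * (μ * y ^ 4 * E) := by
    rw [norm_mul, norm_mul]
    calc _ ≤ (L1 * |y|) * (2 / x * (μ * |y| ^ 3)) * E := by gcongr
      _ = L1 * (2 / x) * (μ * (|y| ^ 2) ^ 2 * E) := by ring
      _ = _ := by rw [sq_abs]; ring
  rw [key]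
  refine (norm_add_le _ _).trans ((add_le_add ((norm_add_le _ _).trans (add_le_add ((norm_add_le _ _).trans (add_le_add n1 n2)) n3)) n4).trans ?_)
  unfold bkW
  rw [← hE]
  have p2 : 0 ≤ y ^ 2 * E := by positivity
  have p4 : 0 ≤ μ * y ^ 4 * E := by positivity
  have p6 : 0 ≤ μ ^ 2 * y ^ 6 * E := by positivity
  have q1 : 0 ≤ H * (4 / x ^ 2) := by positivity
  have q2 : 0 ≤ H * (2 / x ^ 2) := by positivity
  have q3 : 0 ≤ L1 * (2 / x) := by positivity
  have e : (y ^ 2 + μ * y ^ 4 + μ ^ 2 * y ^ 6) * E = y ^ 2 * E + μ * y ^ 4 * E + μ ^ 2 * y ^ 6 * E := by ring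
  rw [e]
  generalize y ^ 2 * E = P2 at *
  generalize μ * y ^ 4 * E = P4 at *
  generalize μ ^ 2 * y ^ 6 * E = P6 at *
  generalize H * (4 / x ^ 2) = Q1 at *
  generalize H * (2 / x ^ 2) = Q2 at *
  generalize L1 * (2 / x) = Q3 at *
  nlinarith [mul_nonneg q1 p2, mul_nonneg q1 p4, mul_nonneg q2 p2, mul_nonneg q2 p6, mul_nonneg q3 p2, mul_nonneg q3 p6, mul_nonneg hL2 p4, mul_nonneg hL2 p6]

/-- the comparison Gaussian is negligible to the left of zero -/
lemma bk_point_neg (v₀ : ℝ) (hv0 : 0 < v₀) (a b d : ℂ) : ∃ C : ℝ, ∀ μ : ℝ, 0 < μ → ∀ v : ℝ, v ≤ 0 →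
    ‖(a + b * (v - v₀ : ℝ) + d * (μ * (v - v₀) ^ 3 : ℝ)) * (Real.exp (-(3 * μ) * (v - v₀) ^ 2) : ℝ)‖
      ≤ C * bkW μ (v - v₀) := by
  refine ⟨‖a‖ / v₀ ^ 2 + ‖b‖ / v₀ + ‖d‖ / v₀, fun μ hμ v hv => ?_⟩
  have hy : v₀ ≤ |v - v₀| := by rw [abs_of_nonpos (by linarith)]; linarith
  generalize v - v₀ = y at *
  have hE : Real.exp (-(3 * μ) * y ^ 2) ≤ Real.exp (-μ * y ^ 2) :=
    Real.exp_le_exp.2 (by nlinarith [mul_nonneg hμ.le (sq_nonneg y)])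
  have hy2 : v₀ ^ 2 ≤ y ^ 2 := by rw [← sq_abs y]; gcongr
  have k1 : 1 ≤ y ^ 2 / v₀ ^ 2 := by rw [le_div_iff₀ (by positivity)]; linarith
  have k2 : |y| ≤ y ^ 2 / v₀ := by rw [le_div_iff₀ hv0, ← sq_abs]; nlinarith [abs_nonneg y]
  have k3 : |y| ^ 3 ≤ y ^ 4 / v₀ := by
    rw [le_div_iff₀ hv0, show y ^ 4 = |y| ^ 3 * |y| by rw [← pow_succ, show (3 + 1) = 2 * 2 by norm_num, pow_mul, sq_abs]; ring]
    gcongr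
  have n : ‖a + b * (y : ℝ) + d * (μ * y ^ 3 : ℝ)‖ ≤ ‖a‖ * (y ^ 2 / v₀ ^ 2) + ‖b‖ * (y ^ 2 / v₀) + ‖d‖ * (μ * (y ^ 4 / v₀)) := by
    refine (norm_add_le _ _).trans (add_le_add ((norm_add_le _ _).trans (add_le_add ?_ ?_)) ?_)
    · exact le_mul_of_one_le_right (norm_nonneg _) k1
    · rw [norm_mul, Complex.norm_real, Real.norm_eq_abs]; gcongr
    · rw [norm_mul, Complex.norm_real, Real.norm_eq_abs, abs_mul, abs_pow, abs_of_pos hμ]; gcongr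
  rw [norm_mul, Complex.norm_real, Real.norm_of_nonneg (Real.exp_pos _).le]
  calc _ ≤ (‖a‖ * (y ^ 2 / v₀ ^ 2) + ‖b‖ * (y ^ 2 / v₀) + ‖d‖ * (μ * (y ^ 4 / v₀))) * Real.exp (-μ * y ^ 2) := by gcongr
    _ ≤ ((‖a‖ / v₀ ^ 2 + ‖b‖ / v₀ + ‖d‖ / v₀) * (y ^ 2 + μ * y ^ 4 + μ ^ 2 * y ^ 6)) * Real.exp (-μ * y ^ 2) := by
      gcongr
      have p2 : 0 ≤ y ^ 2 := by positivity
      have p4 : 0 ≤ μ * y ^ 4 := by positivity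
      have p6 : 0 ≤ μ ^ 2 * y ^ 6 := by positivity
      have q1 : 0 ≤ ‖a‖ / v₀ ^ 2 := by positivity
      have q2 : 0 ≤ ‖b‖ / v₀ := by positivity
      have q3 : 0 ≤ ‖d‖ / v₀ := by positivity
      have e : ‖a‖ * (y ^ 2 / v₀ ^ 2) + ‖b‖ * (y ^ 2 / v₀) + ‖d‖ * (μ * (y ^ 4 / v₀))
        = ‖a‖ / v₀ ^ 2 * y ^ 2 + ‖b‖ / v₀ * y ^ 2 + ‖d‖ / v₀ * (μ * y ^ 4) := by ring
      rw [e]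
      nlinarith [mul_nonneg q1 p4, mul_nonneg q1 p6, mul_nonneg q2 p4, mul_nonneg q2 p6, mul_nonneg q3 p2, mul_nonneg q3 p6]
    _ = _ := by unfold bkW; ring

lemma bk_main_int (μ : ℝ) (hμ : 0 < μ) (v₀ : ℝ) (a b d : ℂ) :
    Integrable (fun v : ℝ => (a + b * (v - v₀ : ℝ) + d * (μ * (v - v₀) ^ 3 : ℝ)) * (Real.exp (-(3 * μ) * (v - v₀) ^ 2) : ℝ)) ∧
    ∫ v : ℝ, (a + b * (v - v₀ : ℝ) + d * (μ * (v - v₀) ^ 3 : ℝ)) * (Real.exp (-(3 * μ) * (v - v₀) ^ 2) : ℝ)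
      = a * (√(π / (3 * μ)) : ℝ) := by
  have i0 : Integrable (fun y : ℝ => ((y ^ 0 * Real.exp (-(3 * μ) * y ^ 2) : ℝ) : ℂ)) := (bk_pow_gauss_int (3 * μ) (by positivity) 0).ofReal (𝕜 := ℂ)
  have i1 : Integrable (fun y : ℝ => ((y ^ 1 * Real.exp (-(3 * μ) * y ^ 2) : ℝ) : ℂ)) := (bk_pow_gauss_int (3 * μ) (by positivity) 1).ofReal (𝕜 := ℂ)
  have i3 : Integrable (fun y : ℝ => ((y ^ 3 * Real.exp (-(3 * μ) * y ^ 2) : ℝ) : ℂ)) := (bk_pow_gauss_int (3 * μ) (by positivity) 3).ofReal (𝕜 := ℂ)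
  have e : ∀ y : ℝ, (a + b * y + d * (μ * y ^ 3 : ℝ)) * (Real.exp (-(3 * μ) * y ^ 2) : ℝ)
      = a * ((y ^ 0 * Real.exp (-(3 * μ) * y ^ 2) : ℝ) : ℂ) + b * ((y ^ 1 * Real.exp (-(3 * μ) * y ^ 2) : ℝ) : ℂ)
        + (d * μ) * ((y ^ 3 * Real.exp (-(3 * μ) * y ^ 2) : ℝ) : ℂ) := by
    intro y; push_cast; ring
  have j01 : Integrable (fun y : ℝ => a * ((y ^ 0 * Real.exp (-(3 * μ) * y ^ 2) : ℝ) : ℂ) + b * ((y ^ 1 * Real.exp (-(3 * μ) * y ^ 2) : ℝ) : ℂ)) := (i0.const_mul a).add (i1.const_mul b)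
  have j := j01.add (i3.const_mul (d * μ))
  have hi : Integrable fun y : ℝ => (a + b * y + d * (μ * y ^ 3 : ℝ)) * (Real.exp (-(3 * μ) * y ^ 2) : ℝ) :=
    j.congr (Eventually.of_forall fun y => (e y).symm)
  refine ⟨hi.comp_sub_right v₀, ?_⟩
  rw [integral_sub_right_eq_self (fun y : ℝ => (a + b * y + d * (μ * y ^ 3 : ℝ)) * (Real.exp (-(3 * μ) * y ^ 2) : ℝ)) v₀]
  simp_rw [e]
  rw [integral_add j01 (i3.const_mul (d * μ)), integral_add (i0.const_mul a) (i1.const_mul b),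
    integral_const_mul, integral_const_mul, integral_const_mul, integral_complex_ofReal, integral_complex_ofReal,
    integral_complex_ofReal, bk_odd_int (fun y => y ^ 1 * Real.exp (-(3 * μ) * y ^ 2)) (fun y => by ring_nf),
    bk_odd_int (fun y => y ^ 3 * Real.exp (-(3 * μ) * y ^ 2)) (fun y => by ring_nf)]
  simp only [pow_zero, one_mul]
  rw [integral_gaussian]
  simp

lemma bk_laplace (x v₀ c : ℝ) (hc : c ≤ 0) (hx : 0 < x) (hv0 : 0 < v₀) (hx3 : 16 * x ^ 3 = 1)
    (hv : v₀ ^ 2 = 3 * x ^ 2) : ∃ C : ℝ, ∀ μ : ℝ, 0 < μ →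
    IntegrableOn (fun v : ℝ => bkZ x v ^ (c : ℂ) *
        Complex.exp (μ * ((bkZ x v ^ 2 - 1 / bkZ x v) - (bkZ x v₀ ^ 2 - 1 / bkZ x v₀)))) (Set.Ioi 0) ∧
    ‖(∫ v in Set.Ioi (0 : ℝ), bkZ x v ^ (c : ℂ) *
        Complex.exp (μ * ((bkZ x v ^ 2 - 1 / bkZ x v) - (bkZ x v₀ ^ 2 - 1 / bkZ x v₀))))
      - bkZ x v₀ ^ (c : ℂ) * (√(π / (3 * μ)) : ℝ)‖ ≤ C * (μ⁻¹ * (√μ)⁻¹) := by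
  obtain ⟨C1, h1⟩ := bk_point x v₀ c hc hx hv0 hx3 hv
  obtain ⟨C2, h2⟩ := bk_point_neg v₀ hv0 (bkZ x v₀ ^ (c : ℂ)) (c * bkZ x v₀ ^ ((c - 1 : ℝ) : ℂ) * Complex.I)
    (bkZ x v₀ ^ (c : ℂ) * (2 * Complex.I / bkZ x v₀))
  refine ⟨max C1 C2 * ∫ y, bkW 1 y, fun μ hμ => ?_⟩
  obtain ⟨hmi, hmv⟩ := bk_main_int μ hμ v₀ (bkZ x v₀ ^ (c : ℂ)) (c * bkZ x v₀ ^ ((c - 1 : ℝ) : ℂ) * Complex.I)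
    (bkZ x v₀ ^ (c : ℂ) * (2 * Complex.I / bkZ x v₀))
  specialize h1 μ hμ
  specialize h2 μ hμ
  set m : ℝ → ℂ := fun v => (bkZ x v₀ ^ (c : ℂ) + (c * bkZ x v₀ ^ ((c - 1 : ℝ) : ℂ) * Complex.I) * (v - v₀ : ℝ)
          + bkZ x v₀ ^ (c : ℂ) * (2 * Complex.I / bkZ x v₀) * (μ * (v - v₀) ^ 3 : ℝ))
        * (Real.exp (-(3 * μ) * (v - v₀) ^ 2) : ℝ) with hm
  set F : ℝ → ℂ := fun v => bkZ x v ^ (c : ℂ) *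
        Complex.exp (μ * ((bkZ x v ^ 2 - 1 / bkZ x v) - (bkZ x v₀ ^ 2 - 1 / bkZ x v₀))) with hF
  have hFc : Continuous F := by
    have hzc := bkZ_cont x
    apply Continuous.mul
    · apply Continuous.cpow hzc continuous_const
      intro v; left; rw [bkZ_re]; exact hx
    · apply Complex.continuous_exp.comp
      apply Continuous.mul continuous_const
      apply Continuous.sub _ continuous_const
      apply Continuous.sub (hzc.pow 2)
      exact continuous_const.div hzc fun v => bkZ_ne x v hx
  have hWn : ∀ y, 0 ≤ bkW μ y := fun y => by unfold bkW; positivity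
  have hb : ∀ v, ‖(Set.Ioi (0 : ℝ)).indicator F v - m v‖ ≤ max C1 C2 * bkW μ (v - v₀) := by
    intro v
    by_cases hvv : 0 < v
    · rw [Set.indicator_of_mem (show v ∈ Set.Ioi (0 : ℝ) from hvv)]
      exact (h1 v hvv).trans (mul_le_mul_of_nonneg_right (le_max_left _ _) (hWn _))
    · rw [Set.indicator_of_notMem (show v ∉ Set.Ioi (0 : ℝ) from hvv), zero_sub, norm_neg]
      exact (h2 v (not_lt.1 hvv)).trans (mul_le_mul_of_nonneg_right (le_max_right _ _) (hWn _))
  have hWi : Integrable fun v => max C1 C2 * bkW μ (v - v₀) := ((bkW_int μ hμ).comp_sub_right v₀).const_mul _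
  have hFm : AEStronglyMeasurable ((Set.Ioi (0 : ℝ)).indicator F) volume :=
    hFc.aestronglyMeasurable.indicator measurableSet_Ioi
  have hdi : Integrable (fun v => (Set.Ioi (0 : ℝ)).indicator F v - m v) :=
    hWi.mono' (hFm.sub hmi.aestronglyMeasurable) (Eventually.of_forall hb)
  have hFi : Integrable ((Set.Ioi (0 : ℝ)).indicator F) := by
    refine (hdi.add hmi).congr (Eventually.of_forall fun v => ?_)
    simp
  refine ⟨(integrable_indicator_iff measurableSet_Ioi).1 hFi, ?_⟩
  rw [← integral_indicator measurableSet_Ioi, ← hmv, ← integral_sub hFi hmi]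
  refine (norm_integral_le_of_norm_le hWi (Eventually.of_forall hb)).trans (le_of_eq ?_)
  rw [integral_const_mul, integral_sub_right_eq_self (bkW μ) v₀, bkW_scale μ hμ]
  ring

lemma bkZ_conj (x v : ℝ) : bkZ x (-v) = (starRingEnd ℂ) (bkZ x v) := by
  apply Complex.ext <;> simp [bkZ]

lemma bk_herm (F : ℝ → ℂ) (hF : ∀ v, F (-v) = (starRingEnd ℂ) (F v)) (hi : IntegrableOn F (Set.Ioi 0)) :
    ∫ v, F v = ((2 * (∫ v in Set.Ioi (0 : ℝ), F v).re : ℝ) : ℂ) := by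
  have e : ∀ v, F v = (starRingEnd ℂ) (F (-v)) := fun v => by rw [hF]; simp
  have h1 : IntegrableOn F (Set.Iic 0) := by
    have h2 : IntegrableOn (fun v => F (-v)) (Set.Ioi 0) := by
      have : (fun v => F (-v)) = fun v => (starRingEnd ℂ) (F v) := funext hF
      rw [this]
      exact Complex.conjCLE.toContinuousLinearMap.integrable_comp hi
    have h3 := ((Measure.measurePreserving_neg (volume : Measure ℝ)).integrableOn_comp_preimage
      (Homeomorph.neg ℝ).measurableEmbedding (f := F) (s := Set.Iic 0)).1
    apply h3
    have : Neg.neg ⁻¹' Set.Iic (0 : ℝ) = Set.Ici 0 := by ext; simp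
    rw [this, integrableOn_Ici_iff_integrableOn_Ioi]
    exact h2
  have h4 : ∫ v in Set.Iic (0 : ℝ), F v = (starRingEnd ℂ) (∫ v in Set.Ioi (0 : ℝ), F v) := by
    rw [← integral_conj, ← neg_zero, ← integral_comp_neg_Iic, neg_zero]
    exact setIntegral_congr_fun measurableSet_Iic fun v _ => e v
  have hu : Integrable F := by
    rw [← integrableOn_univ, ← Set.Iic_union_Ioi (a := (0 : ℝ))]
    exact h1.union hi
  rw [← integral_add_compl (measurableSet_Iic (a := (0 : ℝ))) hu, Set.compl_Iic, h4]
  apply Complex.ext <;> simp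
  ring

lemma bk_scale (n : ℕ) (hn : 1 ≤ n) (η : ℝ) (hη : 0 < η) (x : ℝ) (hx : 0 < x) :
    ((2 * √π * fmn 2 n η : ℝ) : ℂ) = ((η ^ ((2 : ℝ) / 3) * (2 * η ^ ((2 : ℝ) / 3)) ^ (-((n : ℝ) / 2)) : ℝ) : ℂ) *
      ∫ v : ℝ, bkZ x v ^ ((-((n : ℝ) / 2) : ℝ) : ℂ) *
        Complex.exp (((η ^ ((4 : ℝ) / 3) / 4 : ℝ) : ℂ) * (bkZ x v ^ 2 - 1 / bkZ x v)) := by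
  set l := η ^ ((2 : ℝ) / 3) with hl
  have hl0 : 0 < l := by positivity
  have hl2 : η ^ ((4 : ℝ) / 3) = l ^ 2 := by
    rw [hl, ← Real.rpow_natCast, ← Real.rpow_mul hη.le]; norm_num
  have hl3 : l ^ 3 = η ^ 2 := by
    rw [hl, ← Real.rpow_natCast, ← Real.rpow_mul hη.le, ← Real.rpow_natCast]; norm_num
  clear_value l
  rw [hl2, ← bk_rep n hn η hη (l * x) (by positivity)]
  set g : ℝ → ℂ := fun u => Complex.exp ((((l * x : ℝ) : ℂ) + u * Complex.I) ^ 2 / 4) *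
    ((2 * (((l * x : ℝ) : ℂ) + u * Complex.I)) ^ (-((n / 2 : ℝ) : ℂ)) *
      Complex.exp (-η ^ 2 / (4 * (((l * x : ℝ) : ℂ) + u * Complex.I)))) with hg
  have h1 : ∫ u, g u = (l : ℂ) * ∫ v, g (l * v) := by
    rw [Measure.integral_comp_mul_left g l, abs_of_pos (by positivity), Complex.real_smul, ← mul_assoc]
    push_cast
    rw [mul_inv_cancel₀ (by exact_mod_cast hl0.ne'), one_mul]
  have h2 : ∀ v, g (l * v) = (((2 * l) ^ (-((n : ℝ) / 2)) : ℝ) : ℂ) * (bkZ x v ^ ((-((n : ℝ) / 2) : ℝ) : ℂ) *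
        Complex.exp (((l ^ 2 / 4 : ℝ) : ℂ) * (bkZ x v ^ 2 - 1 / bkZ x v))) := by
    intro v
    have hz := bkZ_ne x v hx
    have hlc : (l : ℂ) ≠ 0 := by exact_mod_cast hl0.ne'
    have hl3c : (l : ℂ) ^ 3 = (η : ℂ) ^ 2 := by exact_mod_cast hl3
    have e1 : ((l * x : ℝ) : ℂ) + ((l * v : ℝ) : ℂ) * Complex.I = l * bkZ x v := by
      unfold bkZ; push_cast; ring
    simp only [hg]
    rw [e1, show (2 : ℂ) * (l * bkZ x v) = ((2 * l : ℝ) : ℂ) * bkZ x v by push_cast; ring,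
      bk_mul_cpow (by positivity), Complex.ofReal_cpow (by positivity), ← Complex.ofReal_neg]
    have e2 : Complex.exp (((l ^ 2 / 4 : ℝ) : ℂ) * (bkZ x v ^ 2 - 1 / bkZ x v))
       = Complex.exp ((l * bkZ x v) ^ 2 / 4) * Complex.exp (-(η : ℂ) ^ 2 / (4 * (l * bkZ x v))) := by
      rw [← Complex.exp_add, ← hl3c]
      congr 1
      push_cast
      field_simp
      ring
    rw [e2]
    ring
  change ∫ u, g u = _
  rw [h1]
  simp_rw [h2]
  rw [integral_const_mul]
  push_cast
  ring

lemma bk_const : ∃ x : ℝ, x = 2 ^ (-(4 : ℝ) / 3) ∧ 0 < x ∧ 16 * x ^ 3 = 1 ∧ 3 / 2 * x ^ 2 = 3 * 2 ^ ((1 : ℝ) / 3) / 16 := by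
  refine ⟨_, rfl, by positivity, ?_, ?_⟩
  · rw [← Real.rpow_natCast, ← Real.rpow_mul (by norm_num)]
    norm_num
  · rw [← Real.rpow_natCast, ← Real.rpow_mul (by norm_num)]
    have : (2 : ℝ) ^ ((1 : ℝ) / 3) = 2 ^ (3 : ℝ) * 2 ^ (-(4 : ℝ) / 3 * (2 : ℕ)) := by
      rw [← Real.rpow_add (by norm_num)]; norm_num
    rw [this]
    norm_num
    ring

lemma bk_z0 (x : ℝ) (hx : 0 < x) (c : ℝ) :
    bkZ x (√3 * x) ^ (c : ℂ) = (((2 * x) ^ c : ℝ) : ℂ) * Complex.exp ((c * (π / 3) : ℝ) * Complex.I) := by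
  have h : bkZ x (√3 * x) = ((2 * x : ℝ) : ℂ) * Complex.exp ((π / 3 : ℝ) * Complex.I) := by
    rw [Complex.exp_mul_I, ← Complex.ofReal_cos, ← Complex.ofReal_sin, Real.cos_pi_div_three, Real.sin_pi_div_three]
    unfold bkZ
    push_cast
    ring
  rw [h, bk_mul_cpow (by positivity), Complex.ofReal_cpow (by positivity)]
  congr 1
  rw [Complex.cpow_def_of_ne_zero (Complex.exp_ne_zero _), Complex.log_exp]
  · congr 1; push_cast; ring
  · simp; linarith [pi_pos]
  · simp; linarith [pi_pos]

lemma bk_g0 (x : ℝ) (hx : 0 < x) (hx3 : 16 * x ^ 3 = 1) :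
    bkZ x (√3 * x) ^ 2 - 1 / bkZ x (√3 * x) = ((6 * x ^ 2 : ℝ) : ℂ) * (-1 + (√3 : ℝ) * Complex.I) := by
  have hz := bkZ_ne x (√3 * x) hx
  have h1 : (16 * x ^ 3 : ℂ) = 1 := by exact_mod_cast hx3
  have h3 : ((√3 : ℝ) : ℂ) ^ 2 = 3 := by exact_mod_cast Real.sq_sqrt (show (0 : ℝ) ≤ 3 by norm_num)
  have h4 : 1 / bkZ x (√3 * x) = 4 * x ^ 2 * (1 - (√3 : ℝ) * Complex.I) := by
    rw [div_eq_iff hz]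
    unfold bkZ
    push_cast
    linear_combination (4 * x ^ 3 * ((√3 : ℝ) : ℂ) ^ 2) * Complex.I_sq - 4 * x ^ 3 * h3 - h1
  rw [h4]
  unfold bkZ
  push_cast
  linear_combination (x ^ 2 * ((√3 : ℝ) : ℂ) ^ 2) * Complex.I_sq - x ^ 2 * h3

lemma bk_F_conj (x : ℝ) (hx : 0 < x) (c μ v : ℝ) :
    bkZ x (-v) ^ (c : ℂ) * Complex.exp ((μ : ℂ) * (bkZ x (-v) ^ 2 - 1 / bkZ x (-v)))
      = (starRingEnd ℂ) (bkZ x v ^ (c : ℂ) * Complex.exp ((μ : ℂ) * (bkZ x v ^ 2 - 1 / bkZ x v))) := by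
  have ha : (bkZ x v).arg ≠ π := by
    intro h; rw [Complex.arg_eq_pi_iff, bkZ_re] at h; linarith [h.1]
  rw [bkZ_conj, map_mul, ← Complex.exp_conj]
  congr 1
  · have := Complex.conj_cpow (bkZ x v) (c : ℂ) ha
    rw [this, Complex.conj_ofReal]
  · simp

/-- half-line integral controls the profile exactly -/
lemma bk_exact (n : ℕ) (hn : 1 ≤ n) (η : ℝ) (hη : 0 < η) (x : ℝ) (hx : 0 < x) (hx3 : 16 * x ^ 3 = 1)
    (g₀ : ℂ) (hg₀ : g₀ = bkZ x (√3 * x) ^ 2 - 1 / bkZ x (√3 * x))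
    (hi : IntegrableOn (fun v : ℝ => bkZ x v ^ ((-((n : ℝ) / 2) : ℝ) : ℂ) *
        Complex.exp (((η ^ ((4 : ℝ) / 3) / 4 : ℝ) : ℂ) * ((bkZ x v ^ 2 - 1 / bkZ x v) - g₀))) (Set.Ioi 0)) :
    fmn 2 n η * η ^ ((n : ℝ) / 3) * Real.exp (3 / 2 * x ^ 2 * η ^ ((4 : ℝ) / 3)) =
      (√π)⁻¹ * 2 ^ (-((n : ℝ) / 2)) * η ^ ((2 : ℝ) / 3) *
       (Complex.exp (((√3 * (3 / 2 * x ^ 2) * η ^ ((4 : ℝ) / 3) : ℝ) : ℂ) * Complex.I) *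
        ∫ v in Set.Ioi (0 : ℝ), bkZ x v ^ ((-((n : ℝ) / 2) : ℝ) : ℂ) *
        Complex.exp (((η ^ ((4 : ℝ) / 3) / 4 : ℝ) : ℂ) * ((bkZ x v ^ 2 - 1 / bkZ x v) - g₀))).re := by
  have hs := bk_scale n hn η hη x hx
  set μ := η ^ ((4 : ℝ) / 3) / 4 with hμ
  have hL : η ^ ((4 : ℝ) / 3) = 4 * μ := by rw [hμ]; ring
  rw [hL]
  have e : ∀ v, bkZ x v ^ ((-((n : ℝ) / 2) : ℝ) : ℂ) * Complex.exp ((μ : ℂ) * (bkZ x v ^ 2 - 1 / bkZ x v))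
     = Complex.exp (μ * g₀) * (bkZ x v ^ ((-((n : ℝ) / 2) : ℝ) : ℂ) *
        Complex.exp ((μ : ℂ) * ((bkZ x v ^ 2 - 1 / bkZ x v) - g₀))) := by
    intro v
    rw [mul_left_comm, ← Complex.exp_add]
    congr 2
    ring
  have hi2 : IntegrableOn (fun v => bkZ x v ^ ((-((n : ℝ) / 2) : ℝ) : ℂ) *
      Complex.exp ((μ : ℂ) * (bkZ x v ^ 2 - 1 / bkZ x v))) (Set.Ioi 0) := by
    simp_rw [e]
    exact hi.const_mul _
  rw [bk_herm _ (fun v => bk_F_conj x hx _ μ v) hi2] at hs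
  simp_rw [e] at hs
  rw [integral_const_mul] at hs
  generalize (∫ v in Set.Ioi (0 : ℝ), bkZ x v ^ ((-((n : ℝ) / 2) : ℝ) : ℂ) *
        Complex.exp ((μ : ℂ) * ((bkZ x v ^ 2 - 1 / bkZ x v) - g₀))) = J at *
  rw [← Complex.ofReal_mul, Complex.ofReal_inj] at hs
  have h5 : Complex.exp (μ * g₀) = ((Real.exp (-(3 / 2 * x ^ 2 * (4 * μ))) : ℝ) : ℂ) *
      Complex.exp (((√3 * (3 / 2 * x ^ 2) * (4 * μ) : ℝ) : ℂ) * Complex.I) := by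
    rw [hg₀, bk_g0 x hx hx3, Complex.ofReal_exp, ← Complex.exp_add]
    congr 1
    push_cast
    ring
  rw [h5, mul_assoc (Complex.ofReal _) _ J, Complex.re_ofReal_mul] at hs
  generalize (Complex.exp (((√3 * (3 / 2 * x ^ 2) * (4 * μ) : ℝ) : ℂ) * Complex.I) * J).re = R at *
  have hp : √π ≠ 0 := (Real.sqrt_pos.2 pi_pos).ne'
  have hf : fmn 2 n η = (√π)⁻¹ * (η ^ ((2 : ℝ) / 3) * (2 * η ^ ((2 : ℝ) / 3)) ^ (-((n : ℝ) / 2)) *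
      (Real.exp (-(3 / 2 * x ^ 2 * (4 * μ))) * R)) := by
    rw [eq_inv_mul_iff_mul_eq₀ hp]
    linarith
  have hc : (2 * η ^ ((2 : ℝ) / 3)) ^ (-((n : ℝ) / 2)) * η ^ ((n : ℝ) / 3) = 2 ^ (-((n : ℝ) / 2)) := by
    rw [Real.mul_rpow (by norm_num) (by positivity), ← Real.rpow_mul hη.le, mul_assoc, ← Real.rpow_add hη]
    rw [show (2 : ℝ) / 3 * -((n : ℝ) / 2) + (n : ℝ) / 3 = 0 by ring, Real.rpow_zero, mul_one]
  have he : Real.exp (-(3 / 2 * x ^ 2 * (4 * μ))) * Real.exp (3 / 2 * x ^ 2 * (4 * μ)) = 1 := by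
    rw [← Real.exp_add]; simp
  rw [hf, ← hc]
  linear_combination ((√π)⁻¹ * η ^ ((2 : ℝ) / 3) * (2 * η ^ ((2 : ℝ) / 3)) ^ (-((n : ℝ) / 2)) * η ^ ((n : ℝ) / 3) * R) * he
/-- short time asymptotics of the biharmonic heat kernel profile `f_n = f_{2,n}`
(Evgrafov–Postnikov): with `σ = 3·2^{1/3}/16` and `K_n = (2π)^{-n/2}/(√3·2^{(n-3)/3})`, one has
`f_n(η) = (K_n/(α_n η^{n/3}))·{cos(√3 σ η^{4/3} - nπ/6) + O(η^{-4/3})}·e^{-σ η^{4/3}}` as `η → ∞`. -/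
theorem biharmonic_kernel_asymptotics (n : ℕ) (hn : 1 ≤ n)
    (α : ℝ) (hα : 0 < α)
    (hαdef : α⁻¹ = ∫ x : EuclideanSpace ℝ (Fin n), fmn 2 n ‖x‖) :
    ∃ C > (0 : ℝ), ∃ η₀ > (0 : ℝ), ∀ η : ℝ, η₀ ≤ η →
      |fmn 2 n η * η ^ ((n : ℝ) / 3) * Real.exp ((3 * 2 ^ ((1 : ℝ) / 3) / 16) * η ^ ((4 : ℝ) / 3))
        - ((2 * π) ^ (-(n : ℝ) / 2) / (Real.sqrt 3 * 2 ^ (((n : ℝ) - 3) / 3))) / α *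
            Real.cos (Real.sqrt 3 * (3 * 2 ^ ((1 : ℝ) / 3) / 16) * η ^ ((4 : ℝ) / 3)
              - n * π / 6)|
        ≤ C * η ^ (-(4 : ℝ) / 3) := by
  obtain ⟨x, hxd, hx, hx3, hxσ⟩ := bk_const
  have h3 : (√3) ^ 2 = 3 := Real.sq_sqrt (by norm_num)
  have h30 : 0 < √3 := by positivity
  obtain ⟨C, hC⟩ := bk_laplace x (√3 * x) (-((n : ℝ) / 2)) (by simp; positivity) hx (by positivity) hx3
    (by rw [mul_pow, h3])
  have hp : 0 < √π := Real.sqrt_pos.2 pi_pos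
  refine ⟨(√π)⁻¹ * 2 ^ (-((n : ℝ) / 2)) * (|C| + 1) * 8, by positivity, 1, one_pos, fun η hη1 => ?_⟩
  have hη : 0 < η := by linarith
  have hμ : 0 < η ^ ((4 : ℝ) / 3) / 4 := by positivity
  obtain ⟨hi, hb⟩ := hC _ hμ
  have hex := bk_exact n hn η hη x hx hx3 _ rfl hi
  rw [← hxσ, hex]
  generalize (∫ v in Set.Ioi (0 : ℝ), bkZ x v ^ ((-((n : ℝ) / 2) : ℝ) : ℂ) *
        Complex.exp (((η ^ ((4 : ℝ) / 3) / 4 : ℝ) : ℂ) * ((bkZ x v ^ 2 - 1 / bkZ x v)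
          - (bkZ x (√3 * x) ^ 2 - 1 / bkZ x (√3 * x))))) = J at *
  rw [bk_z0 x hx] at hb
  set θ := √3 * (3 / 2 * x ^ 2) * η ^ ((4 : ℝ) / 3) with hθ
  set l := η ^ ((2 : ℝ) / 3) with hl
  have hl0 : 0 < l := by positivity
  have hl2 : η ^ ((4 : ℝ) / 3) = l ^ 2 := by
    rw [hl, ← Real.rpow_natCast, ← Real.rpow_mul hη.le]; norm_num
  have hl3 : η ^ (-(4 : ℝ) / 3) = (l ^ 2)⁻¹ := by
    rw [← hl2, ← Real.rpow_neg hη.le]; norm_num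
  have hsμ : √(η ^ ((4 : ℝ) / 3) / 4) = l / 2 := by
    rw [hl2, show l ^ 2 / 4 = (l / 2) ^ 2 by ring]; exact Real.sqrt_sq (by positivity)
  have hsq : √(π / (3 * (η ^ ((4 : ℝ) / 3) / 4))) = √π / (√3 * (l / 2)) := by
    rw [Real.sqrt_div pi_pos.le, Real.sqrt_mul (by norm_num), hsμ]
  rw [hsμ, hsq, hl2] at hb
  have hα1 : ((2 * π) ^ (-(n : ℝ) / 2) / (√3 * 2 ^ (((n : ℝ) - 3) / 3))) / α
      = 2 * 2 ^ (-((n : ℝ) / 3)) / √3 := by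
    rw [div_eq_mul_inv _ α, hαdef, bk_alpha n hn]
    have e1 : (2 * π) ^ (-(n : ℝ) / 2) * (2 * π) ^ ((n : ℝ) / 2) = 1 := by
      rw [← Real.rpow_add (by positivity), show -(n : ℝ) / 2 + (n : ℝ) / 2 = 0 by ring, Real.rpow_zero]
    have e2 : (2 * 2 ^ (-((n : ℝ) / 3))) * (2 : ℝ) ^ (((n : ℝ) - 3) / 3) = 1 := by
      nth_rewrite 1 [← Real.rpow_one 2]
      rw [← Real.rpow_add (by norm_num), ← Real.rpow_add (by norm_num),
        show 1 + -((n : ℝ) / 3) + ((n : ℝ) - 3) / 3 = 0 by ring, Real.rpow_zero]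
    have e3 : (2 : ℝ) ^ (((n : ℝ) - 3) / 3) ≠ 0 := by positivity
    rw [div_mul_eq_mul_div, e1, div_eq_div_iff (by positivity) (by positivity), ← e2]
    ring
  have hx2 : (2 : ℝ) ^ (-((n : ℝ) / 2)) * (2 * x) ^ (-((n : ℝ) / 2)) = 2 ^ (-((n : ℝ) / 3)) := by
    rw [← Real.mul_rpow (by norm_num) (by positivity)]
    have : 2 * (2 * x) = 2 ^ ((2 : ℝ) / 3) := by
      rw [hxd, ← mul_assoc, show (2 : ℝ) * 2 = 2 ^ (2 : ℝ) by norm_num, ← Real.rpow_add (by norm_num)]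
      norm_num
    rw [this, ← Real.rpow_mul (by norm_num)]
    congr 1
    ring
  rw [hα1, hl3, ← hx2]
  set P := (√π)⁻¹ * (2 : ℝ) ^ (-((n : ℝ) / 2)) with hP
  have hP0 : 0 < P := by positivity
  set M : ℂ := (((2 * x) ^ (-((n : ℝ) / 2)) : ℝ) : ℂ) *
    Complex.exp ((-((n : ℝ) / 2) * (π / 3) : ℝ) * Complex.I) * ((√π / (√3 * (l / 2)) : ℝ) : ℂ) with hM
  have hMre : (Complex.exp ((θ : ℂ) * Complex.I) * M).re
      = (2 * x) ^ (-((n : ℝ) / 2)) * (√π / (√3 * (l / 2))) * Real.cos (θ - n * π / 6) := by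
    have : Complex.exp ((θ : ℂ) * Complex.I) * M = (((2 * x) ^ (-((n : ℝ) / 2)) * (√π / (√3 * (l / 2))) : ℝ) : ℂ) *
        Complex.exp (((θ - n * π / 6 : ℝ) : ℂ) * Complex.I) := by
      rw [hM, show ((θ - n * π / 6 : ℝ) : ℂ) * Complex.I = (θ : ℂ) * Complex.I +
        (-((n : ℝ) / 2) * (π / 3) : ℝ) * Complex.I by push_cast; ring, Complex.exp_add,
        Complex.ofReal_mul ((2 * x) ^ (-((n : ℝ) / 2)))]
      ring
    rw [this, Complex.re_ofReal_mul, Complex.exp_ofReal_mul_I_re]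
  have hmain : 2 * ((2 : ℝ) ^ (-((n : ℝ) / 2)) * (2 * x) ^ (-((n : ℝ) / 2))) / √3 * Real.cos (θ - n * π / 6)
      = P * l * (Complex.exp ((θ : ℂ) * Complex.I) * M).re := by
    rw [hMre, hP]
    field_simp
  rw [hmain, ← mul_sub, ← Complex.sub_re, ← mul_sub, abs_mul, abs_of_pos (by positivity)]
  have hn2 : |(Complex.exp ((θ : ℂ) * Complex.I) * (J - M)).re| ≤ (|C| + 1) * ((l ^ 2 / 4)⁻¹ * (l / 2)⁻¹) := by
    refine (Complex.abs_re_le_norm _).trans ?_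
    rw [norm_mul, Complex.norm_exp_ofReal_mul_I, one_mul]
    refine hb.trans ?_
    gcongr
    linarith [le_abs_self C]
  calc P * l * |(Complex.exp ((θ : ℂ) * Complex.I) * (J - M)).re|
      ≤ P * l * ((|C| + 1) * ((l ^ 2 / 4)⁻¹ * (l / 2)⁻¹)) := by gcongr
    _ = P * (|C| + 1) * 8 * (l ^ 2)⁻¹ := by field_simp; ring
end
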